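/- arXiv:1711.01106 — 6 statements merged into one kernel-verified Lean document; each statement's English description precedes it below -/
import Mathlib

section
/- Let K be an algebraically closed field, R = K[x_1,…,x_N] a polynomial ring over K, and X an (m×n)-matrix with entries in R, where m ≤ n. Let t be an integer with 1 ≤ t ≤ m and t < n. If the entries of X lying outside the bottom-right (t×t)-submatrix of X (i.e., outside rows m−t+1,…,m and columns n−t+1,…,n) are algebraically dependent over K, then ara I_t(X) ≤ mn − t². -/
/-- The ideal generated by the `t × t` minors of a matrix. -/
def minorsIdeal {R : Type*} [CommRing R] {m n : ℕ} (t : ℕ)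
    (X : Matrix (Fin m) (Fin n) R) : Ideal R :=
  Ideal.span { d | ∃ (r : Fin t → Fin m) (c : Fin t → Fin n),
    Function.Injective r ∧ Function.Injective c ∧ d = (X.submatrix r c).det }

/-- The arithmetical rank of an ideal: the least number of elements generating it
up to radical. -/
noncomputable def araRank {R : Type*} [CommRing R] (I : Ideal R) : ℕ :=
  sInf { r | ∃ f : Fin r → R, (Ideal.span (Set.range f)).radical = I.radical }

namespace AraAux
open Finset

section Bases
variable {K V : Type*} [Field K] [AddCommGroup V] [Module K V] {L : ℕ}

/-- Weight of a set of indices. -/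
def wt {L : ℕ} (S : Finset (Fin L)) : ℕ := ∑ i ∈ S, (i : ℕ)

/-- A spanning independent set with `m` elements. -/
def IsB (v : Fin L → V) (K : Type*) [Field K] [Module K V] (m : ℕ) (S : Finset (Fin L)) : Prop :=
  LinearIndepOn K v (S : Set (Fin L)) ∧ S.card = m

/-- Minimal weight basis. -/
def IsMinB (v : Fin L → V) (K : Type*) [Field K] [Module K V] (m : ℕ) (S : Finset (Fin L)) : Prop :=
  IsB v K m S ∧ ∀ T, IsB v K m T → wt S ≤ wt T

lemma IsMinB.mem_span {v : Fin L → V} {m : ℕ} {S : Finset (Fin L)} (h : IsMinB v K m S)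
    [FiniteDimensional K V] (hm : Module.finrank K V = m) (x : Fin L) :
    v x ∈ Submodule.span K (v '' {i | i ∈ S ∧ i ≤ x}) := by
  classical
  by_cases hx : x ∈ S
  · exact Submodule.subset_span ⟨x, ⟨hx, le_rfl⟩, rfl⟩
  have htop : v x ∈ Submodule.span K (v '' (S : Set (Fin L))) := by
    have h1 := h.1.1
    have h2 : Submodule.span K (Set.range (fun i : S => v i)) = ⊤ := by
      apply LinearIndependent.span_eq_top_of_card_eq_finrank' h1
      simp [h.1.2, hm]
    have h3 : v '' (S : Set (Fin L)) = Set.range (fun i : S => v i) := by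
      ext y; simp
    rw [h3, h2]; trivial
  rw [Submodule.mem_span_image_finset_iff_exists_fun] at htop
  obtain ⟨c₀, hc₀⟩ := htop
  obtain ⟨c, hc⟩ : ∃ c : Fin L → K, ∑ i ∈ S, c i • v i = v x := by
    refine ⟨fun i => if h : i ∈ S then c₀ ⟨i, h⟩ else 0, ?_⟩
    rw [← hc₀, ← Finset.sum_coe_sort]
    exact Finset.sum_congr rfl fun i _ => by simp
  by_cases hall : ∀ y ∈ S, x < y → c y = 0
  · rw [← hc]
    refine Submodule.sum_mem _ fun i hi => ?_
    by_cases hix : i ≤ x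
    · exact Submodule.smul_mem _ _ (Submodule.subset_span ⟨i, ⟨hi, hix⟩, rfl⟩)
    · rw [hall i hi (not_le.1 hix)]; simp
  · push Not at hall
    obtain ⟨y, hy, hxy, hcy⟩ := hall
    exfalso
    have hB : IsB v K m (insert x (S.erase y)) := by
      constructor
      · rw [Finset.coe_insert]
        apply LinearIndepOn.insert
        · exact h.1.1.mono (by simp)
        · intro hmem
          have : v y ∈ Submodule.span K (v '' ((S.erase y : Finset _) : Set (Fin L))) := by
            have e : v y = (c y)⁻¹ • (v x - ∑ i ∈ S.erase y, c i • v i) := by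
              rw [← hc, ← Finset.add_sum_erase S _ hy]
              simp [smul_smul, hcy]
            rw [e]
            refine Submodule.smul_mem _ _ (Submodule.sub_mem _ hmem ?_)
            exact Submodule.sum_mem _ fun i hi =>
              Submodule.smul_mem _ _ (Submodule.subset_span ⟨i, hi, rfl⟩)
          have h5 := h.1.1
          rw [← Finset.insert_erase hy, Finset.coe_insert, linearIndepOn_insert (by simp)] at h5
          exact h5.2 this
      · rw [Finset.card_insert_of_notMem (by simp [hx]), Finset.card_erase_of_mem hy, ← h.1.2]
        have := Finset.card_pos.2 ⟨y, hy⟩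
        omega
    have := h.2 _ hB
    unfold wt at this
    rw [Finset.sum_insert (by simp [hx]), ← Finset.add_sum_erase S _ hy] at this
    have : (x : ℕ) < y := hxy
    omega

lemma IsMinB.unique {v : Fin L → V} {m : ℕ} {S T : Finset (Fin L)} (h : IsMinB v K m S)
    (h' : IsMinB v K m T)
    [FiniteDimensional K V] (hm : Module.finrank K V = m) : S = T := by
  have key : ∀ (S T : Finset (Fin L)), IsMinB v K m S → IsMinB v K m T → ∀ x : Fin L,
      (∀ z < x, z ∈ S ↔ z ∈ T) → x ∈ T → x ∈ S := by
    intro S T h h' x hz hxT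
    by_contra hxS
    have h1 := h.mem_span hm x
    have h2 := h'.1.1
    rw [← Finset.insert_erase hxT, Finset.coe_insert, linearIndepOn_insert (by simp)] at h2
    apply h2.2
    refine Submodule.span_mono (Set.image_mono ?_) h1
    rintro i ⟨hi, hix⟩
    have hne : i ≠ x := fun e => hxS (e ▸ hi)
    simp only [Finset.coe_erase, Set.mem_sdiff, Finset.mem_coe, Set.mem_singleton_iff]
    exact ⟨(hz i (lt_of_le_of_ne hix hne)).1 hi, hne⟩
  ext x
  induction x using WellFoundedLT.induction with
  | ind x ih =>
    exact ⟨key T S h' h x (fun z hz => (ih z hz).symm), key S T h h' x ih⟩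

lemma exists_isMinB (v : Fin L → V) (m : ℕ) (h : ∃ S, IsB v K m S) : ∃ S, IsMinB v K m S := by
  classical
  obtain ⟨S, hS, hmin⟩ := Finset.exists_min_image (univ.filter (IsB v K m)) wt
    (by obtain ⟨S, hS⟩ := h; exact ⟨S, by simpa using hS⟩)
  exact ⟨S, by simpa using hS, fun T hT => hmin T (by simpa using hT)⟩

end Bases

section Minors
/-- Maximal minor on a set of columns. -/
noncomputable def D {R : Type*} [CommRing R] {m L : ℕ} (M : Matrix (Fin m) (Fin L) R)
    (S : Finset (Fin L)) : R :=
  if h : S.card = m then (M.submatrix id (S.orderEmbOfFin h)).det else 0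

lemma D_map {R R' : Type*} [CommRing R] [CommRing R'] (φ : R →+* R') {m L : ℕ}
    (M : Matrix (Fin m) (Fin L) R) (S : Finset (Fin L)) : φ (D M S) = D (M.map φ) S := by
  unfold D
  split_ifs with h
  · rw [RingHom.map_det]; rfl
  · simp

lemma D_ne_zero_iff {K : Type*} [Field K] {m L : ℕ} (M : Matrix (Fin m) (Fin L) K)
    (S : Finset (Fin L)) : D M S ≠ 0 ↔ IsB (fun x i => M i x) K m S := by
  unfold D IsB
  split_ifs with h
  · simp only [h, and_true]
    rw [← isUnit_iff_ne_zero, ← Matrix.isUnit_iff_isUnit_det,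
      ← Matrix.linearIndependent_cols_iff_isUnit]
    exact linearIndependent_equiv' (S.orderIsoOfFin h).toEquiv (by ext; rfl)
  · simp [h]

/-- The matrix extended by a reversed identity matrix. -/
def ext {R : Type*} [CommRing R] {m n : ℕ} (A : Matrix (Fin m) (Fin n) R) :
    Matrix (Fin m) (Fin (n + m)) R :=
  Matrix.of fun i => Fin.addCases (fun c => A i c) (fun j => if i = j.rev then 1 else 0)

lemma ext_map {R R' : Type*} [CommRing R] [CommRing R'] (φ : R →+* R') {m n : ℕ}
    (A : Matrix (Fin m) (Fin n) R) : (ext A).map φ = ext (A.map φ) := by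
  ext i x
  induction x using Fin.addCases <;> simp [ext, apply_ite φ]

/-- Column sets with at least `t` columns in the original matrix. -/
def valid {m n : ℕ} (t : ℕ) (S : Finset (Fin (n + m))) : Prop :=
  t ≤ (S.filter (fun x : Fin (n + m) => (x : ℕ) < n)).card

open Classical in
/-- Sums of minors of the same weight. -/
noncomputable def pw {R : Type*} [CommRing R] {m n : ℕ} (t : ℕ) (A : Matrix (Fin m) (Fin n) R)
    (w : ℕ) : R :=
  ∑ S : Finset (Fin (n + m)) with (valid t S ∧ wt S = (∑ i : Fin m, (i : ℕ)) + w), D (ext A) S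

lemma pw_map {R R' : Type*} [CommRing R] [CommRing R'] (φ : R →+* R') {m n : ℕ} (t : ℕ)
    (A : Matrix (Fin m) (Fin n) R) (w : ℕ) : φ (pw t A w) = pw t (A.map φ) w := by
  unfold pw
  rw [map_sum]
  simp_rw [D_map, ext_map]

lemma strictMono_gap {m : ℕ} (f : Fin m → ℕ) (hf : StrictMono f) (i : Fin m) :
    ∀ (d : ℕ) (h : i + d < m), f i + d ≤ f ⟨i + d, h⟩ := by
  intro d
  induction d with
  | zero => intro h; simp
  | succ d ih =>
    intro h
    have h1 := ih (by omega)
    have h2 : f ⟨i + d, by omega⟩ < f ⟨i + (d + 1), h⟩ := hf (by simp [Fin.lt_def])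
    omega

lemma wt_bounds {m n t : ℕ} (htm : t ≤ m) (htn : t ≤ n) (S : Finset (Fin (n + m)))
    (hS : S.card = m) (hv : valid t S) :
    (∑ i : Fin m, (i : ℕ)) ≤ wt S ∧ wt S ≤ (∑ i : Fin m, (i : ℕ)) + (m * n - t ^ 2) ∧
    (wt S = (∑ i : Fin m, (i : ℕ)) + (m * n - t ^ 2) →
      ∀ x ∈ S, (n - t ≤ (x : ℕ) ∧ (x : ℕ) < n) ∨ n + t ≤ (x : ℕ)) := by
  set f : Fin m → ℕ := fun i => (S.orderEmbOfFin hS i : ℕ) with hf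
  have hmono : StrictMono f := fun i j hij => (S.orderEmbOfFin hS).strictMono hij
  have hwt : wt S = ∑ i, f i := by
    unfold wt
    conv_lhs => rw [← Finset.map_orderEmbOfFin_univ S hS]
    rw [Finset.sum_map]; rfl
  have hlow : ∀ i : Fin m, (i : ℕ) ≤ f i := by
    intro i
    have := strictMono_gap f hmono ⟨0, i.pos⟩ i (by simp)
    simp at this
    omega
  set g : Fin m → ℕ := fun i => i + (if (i : ℕ) < t then n - t else n) with hg
  have hup : ∀ i, f i ≤ g i := by
    intro i
    simp only [hg]
    split_ifs with hit
    · have h1 : f ⟨t - 1, by omega⟩ < n := by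
        by_contra hcon
        have hsub : S.filter (fun x : Fin (n + m) => (x : ℕ) < n) ⊆
            (univ.filter (fun j : Fin m => (j : ℕ) < t - 1)).map
              (S.orderEmbOfFin hS).toEmbedding := by
          intro x hx
          rw [Finset.mem_filter] at hx
          have hx1 := hx.1
          rw [← Finset.map_orderEmbOfFin_univ S hS, Finset.mem_map] at hx1
          obtain ⟨j, -, rfl⟩ := hx1
          refine Finset.mem_map_of_mem _ ?_
          simp only [Finset.mem_filter, Finset.mem_univ, true_and]
          by_contra hj
          have : f ⟨t - 1, by omega⟩ ≤ f j := hmono.monotone (by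
            rw [Fin.le_def]; simp; omega)
          have h3 : f j < n := hx.2
          omega
        have h2 := Finset.card_le_card hsub
        rw [Finset.card_map] at h2
        have h3 : (univ.filter (fun j : Fin m => (j : ℕ) < t - 1)).card ≤ t - 1 := by
          rw [← Finset.card_map Fin.valEmbedding]
          calc _ ≤ (Finset.range (t - 1)).card := Finset.card_le_card (by
                intro x; simp only [Finset.mem_map, Finset.mem_filter, Finset.mem_range]
                rintro ⟨j, hj, rfl⟩; exact hj.2)
            _ = _ := by simp
        unfold valid at hv
        omega
      have h2 := strictMono_gap f hmono i (t - 1 - i) (by omega)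
      have h3 : (⟨i + (t - 1 - i), by omega⟩ : Fin m) = ⟨t - 1, by omega⟩ := by
        apply Fin.ext; simp; omega
      rw [h3] at h2
      omega
    · have h2 := strictMono_gap f hmono i (m - 1 - i) (by omega)
      have h4 : f ⟨i + (m - 1 - i), by omega⟩ < n + m := (S.orderEmbOfFin hS _).2
      omega
  have hsum : ∑ i, g i = (∑ i : Fin m, (i : ℕ)) + (m * n - t ^ 2) := by
    simp only [hg]
    rw [Finset.sum_add_distrib]
    congr 1
    rw [Fin.sum_univ_eq_sum_range (fun i => if i < t then n - t else n) m]
    obtain ⟨a, rfl⟩ := Nat.exists_eq_add_of_le htm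
    obtain ⟨b, rfl⟩ := Nat.exists_eq_add_of_le htn
    rw [Finset.sum_range_add]
    rw [Finset.sum_congr rfl (g := fun _ => b) (by intro x hx; simp at hx; simp [hx])]
    simp
    symm
    apply Nat.sub_eq_of_eq_add
    ring
  refine ⟨?_, ?_, ?_⟩
  · rw [hwt]; exact Finset.sum_le_sum fun i _ => hlow i
  · rw [hwt, ← hsum]; exact Finset.sum_le_sum fun i _ => hup i
  · intro he x hx
    rw [hwt, ← hsum, Finset.sum_eq_sum_iff_of_le (fun i _ => hup i)] at he
    rw [← Finset.map_orderEmbOfFin_univ S hS, Finset.mem_map] at hx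
    obtain ⟨j, -, rfl⟩ := hx
    have h1 : f j = g j := he j (Finset.mem_univ _)
    have h2 : ((S.orderEmbOfFin hS).toEmbedding j : ℕ) = g j := h1
    rw [h2]
    simp only [hg]
    split_ifs <;> omega

end Minors
end AraAux

namespace AraAux
open Finset

lemma exists_rows {K : Type*} [Field K] {m t : ℕ} (A : Matrix (Fin m) (Fin t) K)
    (h : LinearIndependent K A.col) :
    ∃ r : Fin t → Fin m, Function.Injective r ∧ (A.submatrix r id).det ≠ 0 := by
  have h1 : A.rank = t := by simpa using LinearIndependent.rank_matrix (M := A.transpose) h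
  obtain ⟨κ, a, ha, hsp, hli⟩ := exists_linearIndependent' K A.row
  have : Finite κ := Finite.of_injective a ha
  have := Fintype.ofFinite κ
  have hcard : Fintype.card κ = t := by
    rw [← finrank_span_eq_card hli, hsp, ← Matrix.rank_eq_finrank_span_row, h1]
  let e : Fin t ≃ κ := (Fintype.equivFinOfCardEq hcard).symm
  refine ⟨a ∘ e, ha.comp e.injective, ?_⟩
  rw [← isUnit_iff_ne_zero, ← Matrix.isUnit_iff_isUnit_det,
      ← Matrix.linearIndependent_rows_iff_isUnit]
  exact hli.comp e e.injective

lemma pw_eq_zero {K : Type*} [Field K] {m n t : ℕ} (A : Matrix (Fin m) (Fin n) K)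
    (h : ∀ (r : Fin t → Fin m) (c : Fin t → Fin n), Function.Injective r → Function.Injective c →
      (A.submatrix r c).det = 0) (w : ℕ) : pw t A w = 0 := by
  unfold pw
  refine Finset.sum_eq_zero fun S hS => ?_
  simp only [Finset.mem_filter, Finset.mem_univ, true_and] at hS
  by_contra hD
  have hB := (D_ne_zero_iff _ _).1 hD
  obtain ⟨T, hTS, hT⟩ := Finset.exists_subset_card_eq hS.1
  have hlt : ∀ x ∈ T, (x : ℕ) < n := fun x hx => (Finset.mem_filter.1 (hTS hx)).2
  have hmem : ∀ x ∈ T, x ∈ S := fun x hx => (Finset.mem_filter.1 (hTS hx)).1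
  let f := T.orderEmbOfFin hT
  have hfT : ∀ i, f i ∈ T := T.orderEmbOfFin_mem hT
  let c : Fin t → Fin n := fun i => ⟨f i, hlt _ (hfT i)⟩
  have hcf : ∀ i, Fin.castAdd m (c i) = f i := fun i => by ext; simp [c]
  have hc : Function.Injective c := by
    intro i j hij
    apply f.injective
    rw [← hcf, ← hcf, hij]
  have hli : LinearIndependent K (A.submatrix id c).col := by
    have h1 : LinearIndependent K (fun i : S => fun k => ext A k i) := hB.1
    have h2 := h1.comp (fun i : Fin t => (⟨f i, hmem _ (hfT i)⟩ : S))
      (fun i j hij => f.injective (by simpa using hij))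
    convert h2 using 1
    funext i k
    simp [← hcf, ext, Matrix.col]
  obtain ⟨r, hr, hdet⟩ := exists_rows _ hli
  exact hdet (h r c hr hc)

lemma ext_castAdd {R : Type*} [CommRing R] {m n : ℕ} (A : Matrix (Fin m) (Fin n) R) (i j) :
    ext A i (Fin.castAdd m j) = A i j := by simp [ext]

lemma ext_natAdd {R : Type*} [CommRing R] {m n : ℕ} (A : Matrix (Fin m) (Fin n) R) (i j) :
    ext A i (Fin.natAdd n j) = if i = j.rev then 1 else 0 := by simp [ext]

/-- The bottom-right block. -/
def blk {R : Type*} {m n t : ℕ} (htm : t ≤ m) (htn : t ≤ n) (A : Matrix (Fin m) (Fin n) R) :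
    Matrix (Fin t) (Fin t) R :=
  A.submatrix (fun i => ⟨m - t + i, by omega⟩) (fun i => ⟨n - t + i, by omega⟩)

lemma core {K : Type*} [Field K] {m n t : ℕ} (htm : t ≤ m) (htn : t ≤ n)
    (A : Matrix (Fin m) (Fin n) K)
    (hp : ∀ w < m * n - t ^ 2, pw t A w = 0)
    (r : Fin t → Fin m) (c : Fin t → Fin n) (hrc : (A.submatrix r c).det ≠ 0) :
    (∀ (i : Fin m) (j : Fin n), ((i : ℕ) < m - t ∨ (j : ℕ) < n - t) → A i j = 0) ∧ (blk htm htn A).det ≠ 0 := by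
  classical
  set v : Fin (n + m) → (Fin m → K) := fun x i => ext A i x with hv
  have hfr : Module.finrank K (Fin m → K) = m := by simp
  have hex : ∃ S, IsB v K m S := by
    refine ⟨univ.map (Fin.natAddEmb n), ?_, by simp⟩
    have h1 : LinearIndependent K (fun j : Fin m => v (Fin.natAdd n j)) := by
      have h2 := (Pi.basisFun K (Fin m)).linearIndependent.comp Fin.rev Fin.rev_injective
      convert h2 using 1
      funext j i
      simp [hv, ext_natAdd, Pi.single_apply]
    have h3 : ((univ.map (Fin.natAddEmb n) : Finset (Fin (n + m))) : Set (Fin (n + m)))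
        = Set.range (Fin.natAdd (m := m) n) := by
      ext; simp
    rw [h3]
    exact (linearIndepOn_range_iff (Fin.natAdd_injective m n) v).2 h1
  obtain ⟨S, hS⟩ := exists_isMinB v m hex
  have hG := hS.mem_span hfr
  have hvalid : valid t S := by
    unfold valid
    have hli : LinearIndependent K (fun l : Fin t => v (Fin.castAdd m (c l))) := by
      have h1 := Matrix.linearIndependent_cols_of_det_ne_zero hrc
      apply LinearIndependent.of_comp (LinearMap.funLeft K K r)
      have h2 : (LinearMap.funLeft K K r ∘ fun l : Fin t => v (Fin.castAdd m (c l))) =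
          (A.submatrix r c).col := by
        funext l i
        simp [hv, ext_castAdd, LinearMap.funLeft, Matrix.col]
      rw [h2]
      exact h1
    set T := S.filter (fun x : Fin (n + m) => (x : ℕ) < n) with hT
    have hle : Submodule.span K (Set.range (fun l : Fin t => v (Fin.castAdd m (c l)))) ≤
        Submodule.span K ((T.image v : Finset _) : Set (Fin m → K)) := by
      rw [Submodule.span_le]
      rintro _ ⟨l, rfl⟩
      refine Submodule.span_mono ?_ (hG (Fin.castAdd m (c l)))
      rintro _ ⟨i, ⟨hi, hil⟩, rfl⟩
      rw [Finset.coe_image]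
      refine ⟨i, ?_, rfl⟩
      rw [hT, Finset.mem_coe, Finset.mem_filter]
      refine ⟨hi, ?_⟩
      rw [Fin.le_def] at hil
      simp at hil
      omega
    have h2 := Submodule.finrank_mono hle
    rw [finrank_span_eq_card hli] at h2
    have h3 := finrank_span_finset_le_card (R := K) (T.image v)
    have h4 : (T.image v).card ≤ T.card := Finset.card_image_le
    simp only [Fintype.card_fin] at h2
    unfold Set.finrank at h3
    omega
  obtain ⟨hb1, hb2, hb3⟩ := wt_bounds htm htn S hS.1.2 hvalid
  have hw : wt S = (∑ i : Fin m, (i : ℕ)) + (m * n - t ^ 2) := by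
    by_contra hne
    obtain ⟨w, hw⟩ := Nat.exists_eq_add_of_le hb1
    have h0 := hp w (by omega)
    unfold pw at h0
    rw [Finset.sum_eq_single S] at h0
    · exact (D_ne_zero_iff _ _).2 hS.1 h0
    · intro T hT hTS
      by_contra hD
      have hTB := (D_ne_zero_iff _ _).1 hD
      simp only [Finset.mem_filter, Finset.mem_univ, true_and] at hT
      have hTm : IsMinB v K m T := ⟨hTB, fun U hU => by
        rw [hT.2, ← hw]; exact hS.2 U hU⟩
      exact hTS (hTm.unique hS hfr)
    · intro hn
      exact absurd (by simp [hvalid, hw]) hn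
  have hmax := hb3 hw
  have hleft : ∀ i (j : Fin n), (j : ℕ) < n - t → A i j = 0 := by
    intro i j hj
    have h1 := hG (Fin.castAdd m j)
    have h2 : {x | x ∈ S ∧ x ≤ Fin.castAdd m j} = ∅ := by
      ext x
      simp only [Set.mem_ofPred_eq, Set.mem_empty_iff_false, iff_false, not_and, Fin.le_def]
      intro hx
      have := hmax x hx
      simp
      omega
    rw [h2] at h1
    simp only [Set.image_empty, Submodule.span_empty, Submodule.mem_bot] at h1
    have := congrFun h1 i
    simpa [hv, ext_castAdd] using this
  have hz : ∀ j : Fin t, ∃ z : Fin t → K, ∀ i : Fin m,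
      ∑ l : Fin t, z l * A i ⟨n - t + l, by omega⟩ = if (i : ℕ) = m - t + j then 1 else 0 := by
    intro j
    have h1 := hG (Fin.natAdd n ⟨t - 1 - j, by omega⟩)
    have h2 : v (Fin.natAdd n ⟨t - 1 - j, by omega⟩) ∈
        Submodule.span K (Set.range (fun l : Fin t => (fun i => A i ⟨n - t + l, by omega⟩))) := by
      refine Submodule.span_mono ?_ h1
      rintro _ ⟨x, ⟨hx, hxl⟩, rfl⟩
      have h3 := hmax x hx
      rw [Fin.le_def] at hxl
      simp at hxl
      have h4 : n - t ≤ (x : ℕ) ∧ (x : ℕ) < n := by omega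
      refine ⟨⟨x - (n - t), by omega⟩, ?_⟩
      have h5 : x = Fin.castAdd m ⟨n - t + (x - (n - t)), by omega⟩ := by
        ext; simp; omega
      funext i
      rw [hv]
      dsimp only
      conv_rhs => rw [h5]
      rw [ext_castAdd]
    rw [Submodule.mem_span_range_iff_exists_fun] at h2
    obtain ⟨z, hz⟩ := h2
    refine ⟨z, fun i => ?_⟩
    have h6 := congrFun hz i
    simp only [Finset.sum_apply, Pi.smul_apply, smul_eq_mul, hv, ext_natAdd] at h6
    rw [h6]
    congr 1
    rw [Fin.ext_iff]
    simp
    omega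
  choose z hz using hz
  have hYZ : blk htm htn A * Matrix.of (fun l j => z j l) = 1 := by
    ext i j
    have := hz j ⟨m - t + i, by omega⟩
    rw [Matrix.mul_apply, Matrix.one_apply]
    simp only [Nat.add_left_cancel_iff, ← Fin.ext_iff] at this
    rw [← this]
    exact Finset.sum_congr rfl fun l _ => by simp [blk, mul_comm]
  have hZY := mul_eq_one_comm.1 hYZ
  refine ⟨?_, ?_⟩
  · rintro i j hij
    by_cases hj : (j : ℕ) < n - t
    · exact hleft i j hj
    have hi : (i : ℕ) < m - t := by omega
    set b : Fin t → K := fun l => A i ⟨n - t + l, by omega⟩ with hb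
    have h0 : Matrix.vecMul b (Matrix.of (fun l j => z j l)) = 0 := by
      funext j
      have := hz j i
      rw [if_neg (by omega)] at this
      simp only [Matrix.vecMul, dotProduct, Matrix.of_apply, Pi.zero_apply]
      rw [← this]
      exact Finset.sum_congr rfl fun l _ => mul_comm _ _
    have h1 : b = 0 := by
      have := congrArg (fun u => Matrix.vecMul u (blk htm htn A)) h0
      simpa [Matrix.vecMul_vecMul, hZY] using this
    have h2 := congrFun h1 ⟨j - (n - t), by omega⟩
    simp only [hb, Pi.zero_apply] at h2
    rw [← h2]
    congr 1
    ext; simp; omega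
  · intro h0
    have := congrArg Matrix.det hYZ
    rw [Matrix.det_mul, h0] at this
    simp at this

end AraAux

namespace AraAux

/-- An auxiliary direction and polynomial detecting the hypersurface `F = 0`. -/
lemma exists_dir {K : Type*} [Field K] [Infinite K] {σ : Type*} (p₀ : σ)
    (F : MvPolynomial σ K) (hF : F ≠ 0) :
    ∃ (e : σ → K) (u : Polynomial K), e p₀ ≠ 0 ∧ ∀ (a : σ → K) (d : K), d ≠ 0 →
      MvPolynomial.eval a F = 0 → ∃ p, a p + d * u.eval ((e p₀)⁻¹ * a p₀) * e p ≠ 0 := by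
  have h1 : F * MvPolynomial.X p₀ ≠ 0 := mul_ne_zero hF (MvPolynomial.X_ne_zero p₀)
  obtain ⟨e, he⟩ : ∃ e : σ → K, MvPolynomial.eval e (F * MvPolynomial.X p₀) ≠ 0 := by
    by_contra hcon
    push Not at hcon
    exact h1 (MvPolynomial.funext fun x => by rw [hcon x]; simp)
  simp only [map_mul, MvPolynomial.eval_X] at he
  have heF := left_ne_zero_of_mul he
  have hep := right_ne_zero_of_mul he
  set g : Polynomial K := MvPolynomial.aeval (fun p => Polynomial.C (e p) * Polynomial.X) F with hg
  have hge : ∀ s : K, g.eval s = MvPolynomial.eval (fun p => s * e p) F := by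
    intro s
    rw [hg, ← Polynomial.coe_evalRingHom, MvPolynomial.aeval_def, MvPolynomial.hom_eval₂]
    rw [← MvPolynomial.eval₂_id]
    congr 1
    · ext x; simp
    · funext p; exact (by simp : _ = e p * s).trans (mul_comm _ _)
  have hg0 : g ≠ 0 := by
    intro h0
    have := hge 1
    rw [h0] at this
    simp at this
    exact heF this.symm
  obtain ⟨u, hu, hnd⟩ := g.exists_eq_pow_rootMultiplicity_mul_and_not_dvd hg0 0
  rw [Polynomial.dvd_iff_isRoot, Polynomial.IsRoot.def] at hnd
  refine ⟨e, u, hep, fun a d hd ha => ?_⟩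
  by_contra hcon
  push Not at hcon
  set s : K := - (d * u.eval ((e p₀)⁻¹ * a p₀)) with hs
  have has : ∀ p, a p = s * e p := fun p => by
    have := hcon p
    rw [hs]; linear_combination this
  have hl : (e p₀)⁻¹ * a p₀ = s := by rw [has p₀]; field_simp
  have hgs : g.eval s = 0 := by
    rw [hge, ← ha]; congr 2; funext p; exact (has p).symm
  rw [hl] at hs
  rw [hu] at hgs
  simp only [Polynomial.eval_mul, Polynomial.eval_pow, map_zero, sub_zero, Polynomial.eval_X] at hgs
  have hs0 : s = 0 := by
    rcases mul_eq_zero.1 hgs with h | h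
    · exact eq_zero_of_pow_eq_zero h
    · rw [hs, h]; simp
  rw [hs0] at hs
  have : d * u.eval 0 = 0 := by linear_combination hs
  rcases mul_eq_zero.1 this with h | h
  · exact hd h
  · exact hnd h

end AraAux

/-- If the entries of `X` lying outside the bottom-right `t × t` submatrix are
algebraically dependent over the algebraically closed field `K`, then
`ara I_t(X) ≤ mn - t²`. -/
theorem stmt0 {K : Type*} [Field K] [IsAlgClosed K] (N m n t : ℕ)
    (X : Matrix (Fin m) (Fin n) (MvPolynomial (Fin N) K))
    (hmn : m ≤ n) (ht1 : 1 ≤ t) (htm : t ≤ m) (htn : t < n)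
    (hdep : ∃ F : MvPolynomial {p : Fin m × Fin n // (p.1 : ℕ) < m - t ∨ (p.2 : ℕ) < n - t} K,
      F ≠ 0 ∧ MvPolynomial.aeval (fun p => X p.1.1 p.1.2) F = 0) :
    araRank (minorsIdeal t X) ≤ m * n - t ^ 2 := by
  classical
  have htn' : t ≤ n := htn.le
  obtain ⟨F, hF, hFX⟩ := hdep
  let p₀ : {p : Fin m × Fin n // (p.1 : ℕ) < m - t ∨ (p.2 : ℕ) < n - t} :=
    ⟨(⟨0, by omega⟩, ⟨0, by omega⟩), Or.inr (by simp; omega)⟩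
  obtain ⟨e, u, hep, hu⟩ := AraAux.exists_dir p₀ F hF
  let δ := (AraAux.blk htm htn' X).det
  let X' : Matrix (Fin m) (Fin n) (MvPolynomial (Fin N) K) := Matrix.of fun i j =>
    if h : (i : ℕ) < m - t ∨ (j : ℕ) < n - t then
      X i j + δ * Polynomial.aeval (MvPolynomial.C (e p₀)⁻¹ * X p₀.1.1 p₀.1.2) u *
        MvPolynomial.C (e ⟨(i, j), h⟩)
    else X i j
  apply Nat.sInf_le
  refine ⟨fun w => AraAux.pw t X' w, ?_⟩
  rw [← MvPolynomial.vanishingIdeal_zeroLocus_eq_radical (K := K),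
    ← MvPolynomial.vanishingIdeal_zeroLocus_eq_radical (K := K)]
  congr 1
  unfold minorsIdeal
  rw [MvPolynomial.zeroLocus_span, MvPolynomial.zeroLocus_span]
  ext x
  simp only [Set.mem_ofPred_eq, Set.forall_mem_range]
  set φ : MvPolynomial (Fin N) K →+* K := (MvPolynomial.aeval x : _ →ₐ[K] K).toRingHom with hφ
  have hφa : ∀ p, MvPolynomial.aeval x p = φ p := fun p => rfl
  simp only [hφa, AraAux.pw_map]
  set d : K := φ δ with hd
  have hdY : d = (AraAux.blk htm htn' (X.map φ)).det := by
    rw [hd]; simp only [δ]; rw [RingHom.map_det]; rfl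
  have hY' : AraAux.blk htm htn' (X'.map φ) = AraAux.blk htm htn' (X.map φ) := by
    ext i j
    simp [AraAux.blk, X']
  have hX'd : d = 0 → X'.map φ = X.map φ := by
    intro h0
    ext i j
    simp only [Matrix.map_apply, X', Matrix.of_apply]
    split_ifs with h
    · rw [map_add, map_mul, map_mul, ← hd, h0]; simp
    · rfl
  have hiff : (∀ p, (∃ (r : Fin t → Fin m) (c : Fin t → Fin n), Function.Injective r ∧
      Function.Injective c ∧ p = (X.submatrix r c).det) → φ p = 0) ↔
      ∀ (r : Fin t → Fin m) (c : Fin t → Fin n), Function.Injective r → Function.Injective c →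
        ((X.map φ).submatrix r c).det = 0 := by
    constructor
    · intro h r c hr hc
      have := h _ ⟨r, c, hr, hc, rfl⟩
      rw [RingHom.map_det] at this
      exact this
    · rintro h _ ⟨r, c, hr, hc, rfl⟩
      rw [RingHom.map_det]
      exact h r c hr hc
  rw [hiff]
  constructor
  · intro h r c hr hc
    by_contra hdet
    by_cases h0 : d = 0
    · rw [hX'd h0] at h
      have := (AraAux.core htm htn' (X.map φ) (fun w hw => h ⟨w, hw⟩) r c hdet).2
      exact this (hdY ▸ h0)
    · have hb : (AraAux.blk htm htn' (X'.map φ)).det ≠ 0 := by rw [hY', ← hdY]; exact h0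
      have hz := (AraAux.core htm htn' (X'.map φ) (fun w hw => h ⟨w, hw⟩) _ _ hb).1
      have hFa : MvPolynomial.eval (fun p : {p : Fin m × Fin n // (p.1 : ℕ) < m - t ∨
          (p.2 : ℕ) < n - t} => φ (X p.1.1 p.1.2)) F = 0 := by
        have h1 := congrArg φ hFX
        rw [map_zero, MvPolynomial.aeval_def, MvPolynomial.hom_eval₂] at h1
        rw [← h1, ← MvPolynomial.eval₂_id]
        congr 1
        ext y
        simp [hφ, MvPolynomial.algebraMap_eq]
      obtain ⟨p, hp⟩ := hu _ d h0 hFa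
      apply hp
      have h2 := hz p.1.1 p.1.2 p.2
      simp only [Matrix.map_apply, X', Matrix.of_apply] at h2
      rw [dif_pos p.2, map_add, map_mul, map_mul, ← hd] at h2
      have hC : ∀ y : K, φ (MvPolynomial.C y) = y := fun y => by simp [hφ]
      have h3 : φ (Polynomial.aeval (MvPolynomial.C (e p₀)⁻¹ * X p₀.1.1 p₀.1.2) u) =
          u.eval ((e p₀)⁻¹ * φ (X p₀.1.1 p₀.1.2)) := by
        rw [← hφa, ← Polynomial.aeval_algHom_apply, hφa, map_mul, hC]
        simp
      rw [h3, hC] at h2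
      exact h2
  · intro h w
    have h0 : d = 0 := by
      rw [hdY]
      apply h
      · intro i j hij; simpa [Fin.ext_iff] using hij
      · intro i j hij; simpa [Fin.ext_iff] using hij
    rw [hX'd h0]
    exact AraAux.pw_eq_zero _ h _
end

section
/- Let K be an algebraically closed field, R = K[x_1,…,x_N] a polynomial ring over K, and X an (m×n)-matrix with entries in R, where m ≤ n. Let t be an integer with 1 ≤ t ≤ m and t < n. If there exist t rows and t columns of X such that the entries of X lying outside the corresponding (t×t)-submatrix are algebraically dependent over K, then ara I_t(X) ≤ mn − t². -/
open Module Submodule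

lemma aux_card_le {L V : Type*} [Field L] [AddCommGroup V] [Module L V] {ι κ : Type*}
    [Fintype ι] [Fintype κ] (v : ι → V) (hv : LinearIndependent L v) (w : κ → V)
    (h : ∀ i, v i ∈ span L (Set.range w)) : Fintype.card ι ≤ Fintype.card κ := by
  have h1 : span L (Set.range v) ≤ span L (Set.range w) := by
    rw [span_le]; rintro _ ⟨i, rfl⟩; exact h i
  have h2 := finrank_span_eq_card hv
  haveI : FiniteDimensional L (span L (Set.range w)) :=
    FiniteDimensional.span_of_finite L (Set.finite_range w)
  have h3 := Submodule.finrank_mono h1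
  have h4 := finrank_range_le_card (R := L) w
  unfold Set.finrank at h4
  omega

lemma aux_greedy {L V : Type*} [Field L] [AddCommGroup V] [Module L V] [FiniteDimensional L V]
    {m M : ℕ} (hm : finrank L V = m) (a : Fin M → V) (ha : span L (Set.range a) = ⊤) :
    ∃ u : Fin m ↪o Fin M, LinearIndependent L (a ∘ u) ∧
      ∀ j, a j ∈ span L ((a ∘ u) '' {k | u k ≤ j}) := by
  classical
  set U : Finset (Fin M) := Finset.univ.filter (fun j => a j ∉ span L (a '' Set.Iio j)) with hU
  have h1 : ∀ j, a j ∈ span L (a '' {x | x ∈ U ∧ x ≤ j}) := by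
    intro j
    induction j using WellFoundedLT.induction with
    | ind j ih =>
      by_cases hj : j ∈ U
      · exact subset_span ⟨j, ⟨hj, le_rfl⟩, rfl⟩
      · have : a j ∈ span L (a '' Set.Iio j) := by
          by_contra h; exact hj (by simp [hU, h])
        refine (span_le.2 ?_) this
        rintro _ ⟨i, hi, rfl⟩
        refine span_mono ?_ (ih i hi)
        apply Set.image_mono
        rintro x ⟨hx, hxi⟩
        exact ⟨hx, hxi.trans (le_of_lt hi)⟩
  have h2 : ∀ s : Finset (Fin M), s ⊆ U → LinearIndepOn L a (s : Set (Fin M)) := by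
    intro s
    induction s using Finset.induction_on_max with
    | empty => intro _; simp
    | insert x s hx ih =>
      intro hs
      rw [Finset.coe_insert]
      apply LinearIndepOn.insert (ih (fun y hy => hs (Finset.mem_insert_of_mem hy)))
      have : x ∈ U := hs (Finset.mem_insert_self _ _)
      simp only [hU, Finset.mem_filter, Finset.mem_univ, true_and] at this
      intro h
      apply this
      refine span_mono (Set.image_mono ?_) h
      intro y hy
      exact hx y hy
  have h3 := h2 U subset_rfl
  have h4 : span L (a '' (U : Set (Fin M))) = ⊤ := by
    rw [eq_top_iff, ← ha, span_le]
    rintro _ ⟨j, rfl⟩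
    exact span_mono (Set.image_mono (fun x hx => hx.1)) (h1 j)
  have hcard : U.card = m := by
    have h5 := finrank_span_eq_card (R := L) (b := fun x : (U : Set (Fin M)) => a x) h3
    have h6 : Set.range (fun x : (U : Set (Fin M)) => a x) = a '' (U : Set (Fin M)) := by
      ext; simp
    rw [h6, h4, finrank_top, hm] at h5
    rw [h5]; simp
  refine ⟨U.orderEmbOfFin hcard, ?_, ?_⟩
  · let g : Fin m → (U : Set (Fin M)) := fun i => ⟨U.orderEmbOfFin hcard i, U.orderEmbOfFin_mem hcard i⟩
    have hg : Function.Injective g := by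
      intro i j h
      simpa [g] using h
    exact LinearIndependent.comp h3 g hg
  · intro j
    refine span_mono ?_ (h1 j)
    rintro _ ⟨x, ⟨hx, hxj⟩, rfl⟩
    have : x ∈ Set.range (U.orderEmbOfFin hcard) := by
      rw [Finset.range_orderEmbOfFin]; exact hx
    obtain ⟨k, rfl⟩ := this
    exact ⟨k, hxj, rfl⟩

lemma aux_gale {L V : Type*} [Field L] [AddCommGroup V] [Module L V]
    {m M : ℕ} (a : Fin M → V) (u : Fin m ↪o Fin M)
    (hu : ∀ j, a j ∈ span L ((a ∘ u) '' {k | u k ≤ j}))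
    {q : ℕ} (e : Fin q → Fin M) (he : LinearIndependent L (a ∘ e)) (i : Fin m) 
    (hlt : ∀ k, e k < u i) : q ≤ i := by
  have := aux_card_le (a ∘ e) he (fun k : Fin (i : ℕ) => a (u ⟨k, k.2.trans i.2⟩)) (by
    intro k
    refine span_mono ?_ (hu (e k))
    rintro _ ⟨l, hl, rfl⟩
    have : u l < u i := lt_of_le_of_lt hl (hlt k)
    have : l < i := by simpa using this
    exact ⟨⟨l, this⟩, rfl⟩)
  simpa using this

lemma aux_gale' {L V : Type*} [Field L] [AddCommGroup V] [Module L V]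
    {m M : ℕ} (a : Fin M → V) (u : Fin m ↪o Fin M)
    (hu : ∀ j, a j ∈ span L ((a ∘ u) '' {k | u k ≤ j}))
    (e : Fin m ↪o Fin M) (he : LinearIndependent L (a ∘ e)) (i : Fin m) : u i ≤ e i := by
  by_contra h
  push Not at h
  have hi := i.2
  have := aux_gale a u hu (q := i + 1) (fun k => e ⟨k, by omega⟩)
    (he.comp (fun k : Fin (i+1) => (⟨k, by omega⟩ : Fin m)) (by
      intro x y hxy; simpa [Fin.ext_iff] using hxy)) i (by
      intro k
      refine lt_of_le_of_lt ?_ h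
      apply e.monotone
      rw [Fin.le_def]
      simp; omega)
  omega

/-- step 1 -/
lemma aux_dep {K R : Type*} [Field K] [Infinite K] [CommRing R] [Algebra K R] {ι : Type*} 
    (u : ι → R) (F : MvPolynomial ι K) (hF : F ≠ 0) (hFu : MvPolynomial.aeval u F = 0) (δ : R) :
    ∃ p : ι → R, ∀ (L : Type _) [Field L] (φ : R →+* L),
      (∀ j, φ (u j - δ * p j) = 0) → φ δ = 0 := by
  obtain ⟨a, ha⟩ : ∃ a : ι → K, MvPolynomial.eval a F ≠ 0 := by
    by_contra h
    push Not at h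
    exact hF (MvPolynomial.funext (by simpa using h))
  by_cases h0 : a = 0
  · refine ⟨0, fun L _ φ h => ?_⟩
    exfalso
    have h1 : ∀ j, φ (u j) = 0 := by simpa using h
    have h2 := congrArg φ hFu
    letI : Algebra K L := (φ.comp (algebraMap K R)).toAlgebra
    let ψ : R →ₐ[K] L := { φ with commutes' := fun _ => rfl }
    have h3 : MvPolynomial.aeval (fun j => ψ (u j)) F = 0 := by
      rw [← MvPolynomial.comp_aeval_apply, hFu, map_zero]
    have h4 : (fun j => ψ (u j)) = fun j => algebraMap K L (a j) := by
      funext j; exact (h1 j).trans (by rw [h0]; simp)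
    rw [h4] at h3
    have h5 := MvPolynomial.aeval_algebraMap_apply (R := K) (A := K) L a F
    rw [show (fun j => algebraMap K L (a j)) = algebraMap K L ∘ a from rfl, h5] at h3
    simp at h3
    exact ha (by simpa [MvPolynomial.aeval_eq_eval] using h3)
  · obtain ⟨j0, hj0⟩ := Function.ne_iff.1 h0
    let P : Polynomial K := MvPolynomial.aeval (fun j => Polynomial.C (a j) * Polynomial.X) F
    have hP : P ≠ 0 := by
      intro h
      have : Polynomial.aeval (1:K) P = 0 := by rw [h]; simp
      simp only [P] at this
      rw [MvPolynomial.comp_aeval_apply] at this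
      apply ha
      simpa [MvPolynomial.aeval_eq_eval] using this
    obtain ⟨Q, hPQ, hQ⟩ := Polynomial.exists_eq_pow_rootMultiplicity_mul_and_not_dvd P hP 0
    set e := P.rootMultiplicity 0
    have hQ0 : Q.eval 0 ≠ 0 := by
      intro h
      exact hQ (Polynomial.dvd_iff_isRoot.2 h)
    let q : R := Polynomial.aeval (algebraMap K R (a j0)⁻¹ * u j0) Q
    refine ⟨fun j => algebraMap K R (a j) * q, fun L _ φ h => ?_⟩
    letI : Algebra K L := (φ.comp (algebraMap K R)).toAlgebra
    let ψ : R →ₐ[K] L := { φ with commutes' := fun _ => rfl }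
    have hψ : ∀ x, φ x = ψ x := fun _ => rfl
    simp only [hψ] at h ⊢
    have h1 : ∀ j, ψ (u j) = algebraMap K L (a j) * (ψ δ * ψ q) := by
      intro j
      have := h j
      rw [map_sub, sub_eq_zero, map_mul, map_mul, AlgHom.commutes] at this
      rw [this]; ring
    set s := ψ δ * ψ q with hs
    have hq : ψ q = Polynomial.aeval s Q := by
      simp only [q]
      rw [← Polynomial.aeval_algHom_apply, map_mul, AlgHom.commutes, h1, ← mul_assoc, ← map_mul,
        inv_mul_cancel₀ hj0, map_one, one_mul]
    have hPs : Polynomial.aeval s P = 0 := by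
      have h3 : MvPolynomial.aeval (fun j => ψ (u j)) F = 0 := by
        rw [← MvPolynomial.comp_aeval_apply, hFu, map_zero]
      simp only [P]
      rw [MvPolynomial.comp_aeval_apply, ← h3]
      congr 2
      funext j
      rw [h1]; simp
    rw [hPQ] at hPs
    simp only [map_mul, map_pow, map_sub, Polynomial.aeval_X, map_zero, sub_zero, mul_eq_zero] at hPs
    have key : s = 0 := by
      rcases hPs with h | h
      · exact by by_contra hne; exact (pow_ne_zero _ hne) h
      · rw [← hq] at h
        rw [hs, h, mul_zero]
    have hqn : ψ q ≠ 0 := by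
      rw [hq, key, ← map_zero (algebraMap K L), Polynomial.aeval_algebraMap_apply]
      simpa using hQ0
    exact (mul_eq_zero.1 key).resolve_right hqn

lemma aux_minor {L : Type*} [Field L] {m t : ℕ} (B : Matrix (Fin m) (Fin t) L)
    (hB : LinearIndependent L B.col) :
    ∃ r : Fin t → Fin m, Function.Injective r ∧ (B.submatrix r id).det ≠ 0 := by
  classical
  obtain ⟨κ, a, ha, hsp, hli⟩ := exists_linearIndependent' L B.row
  have : Finite κ := Finite.of_injective a ha
  have : Fintype κ := Fintype.ofFinite κ
  have hrank : B.rank = t := by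
    have := LinearIndependent.rank_matrix (M := B.transpose) hB
    rw [Matrix.rank_transpose] at this
    simpa using this
  have hc : Fintype.card κ = t := by
    rw [← finrank_span_eq_card hli, hsp, ← Matrix.rank_eq_finrank_span_row, hrank]
  let e : Fin t ≃ κ := (Fintype.equivFinOfCardEq hc).symm
  refine ⟨a ∘ e, ha.comp e.injective, ?_⟩
  have h1 : LinearIndependent L (B.submatrix (a ∘ e) id).row := hli.comp e e.injective
  rw [Matrix.linearIndependent_rows_iff_isUnit, Matrix.isUnit_iff_isUnit_det] at h1
  exact h1.ne_zero

lemma aux_indep {L : Type*} [Field L] {m n t : ℕ} (Y : Matrix (Fin m) (Fin n) L)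
    (r : Fin t → Fin m) (c : Fin t → Fin n) (h : (Y.submatrix r c).det ≠ 0) :
    LinearIndependent L (Y.col ∘ c) := by
  have h1 : LinearIndependent L (Y.submatrix r c).col := by
    rw [Matrix.linearIndependent_cols_iff_isUnit, Matrix.isUnit_iff_isUnit_det]
    exact h.isUnit
  exact LinearIndependent.of_comp (LinearMap.funLeft L L r) h1

lemma aux_perm {m : ℕ} (p q : Fin m → Prop) [DecidablePred p] [DecidablePred q]
    (h : Nat.card {x // p x} = Nat.card {x // q x}) :
    ∃ π : Fin m ≃ Fin m, ∀ l, q (π l) ↔ p l := by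
  have h' : Fintype.card {x // p x} = Fintype.card {x // q x} := by
    rwa [Nat.card_eq_fintype_card, Nat.card_eq_fintype_card] at h
  let e := Fintype.equivOfCardEq h'
  refine ⟨e.extendSubtype, fun l => ⟨fun hq => ?_, fun hp => e.extendSubtype_mem l hp⟩⟩
  by_contra hp
  exact e.extendSubtype_not_mem l hp hq

/-- the matrix `(X | J)` with permuted columns -/
def extMat {R : Type*} [CommRing R] {m n : ℕ} (X : Matrix (Fin m) (Fin n) R)
    (τ : Fin n ≃ Fin n) (π : Fin m ≃ Fin m) : Matrix (Fin m) (Fin (n + m)) R :=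
  fun i => Fin.addCases (fun j => X i (τ j)) (fun l => if i = π l then 1 else 0)

open Classical in
/-- Sum of the maximal minors of `(X | J)` of a given level. -/
noncomputable def levelSum {R : Type*} [CommRing R] {m n : ℕ} (t : ℕ)
    (X : Matrix (Fin m) (Fin n) R)
    (τ : Fin n ≃ Fin n) (π : Fin m ≃ Fin m) (k : ℕ) : R :=
  ∑ e ∈ (Finset.univ : Finset (Fin m ↪o Fin (n + m))).filter
    (fun e => (∀ i : Fin m, (i : ℕ) < t → (e i : ℕ) < n) ∧
      ∑ i, (e i : ℕ) = k + ∑ i : Fin m, (i : ℕ)), ((extMat X τ π).submatrix id e).det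

lemma extMat_map {R S : Type*} [CommRing R] [CommRing S] (φ : R →+* S) {m n : ℕ}
    (X : Matrix (Fin m) (Fin n) R) (τ : Fin n ≃ Fin n) (π : Fin m ≃ Fin m) :
    (extMat X τ π).map φ = extMat (X.map φ) τ π := by
  ext i j
  refine Fin.addCases (fun j => ?_) (fun l => ?_) j
  · simp [extMat]
  · simp only [extMat, Matrix.map_apply, Fin.addCases_right]
    split_ifs <;> simp

lemma levelSum_map {R S : Type*} [CommRing R] [CommRing S] (φ : R →+* S) {m n : ℕ} (t : ℕ)
    (X : Matrix (Fin m) (Fin n) R) (τ : Fin n ≃ Fin n) (π : Fin m ≃ Fin m) (k : ℕ) :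
    φ (levelSum t X τ π k) = levelSum t (X.map φ) τ π k := by
  unfold levelSum
  rw [map_sum]
  refine Finset.sum_congr rfl fun e _ => ?_
  rw [RingHom.map_det, ← extMat_map]
  rfl

lemma aux_cols {L : Type*} [Field L] {m M : ℕ} (A : Matrix (Fin m) (Fin M) L) (e : Fin m → Fin M) :
    (A.submatrix id e).det ≠ 0 ↔ LinearIndependent L (A.col ∘ e) := by
  have : A.col ∘ e = (A.submatrix id e).col := rfl
  rw [this, Matrix.linearIndependent_cols_iff_isUnit, Matrix.isUnit_iff_isUnit_det, isUnit_iff_ne_zero]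

lemma levelSum_zero {L : Type*} [Field L] {m n : ℕ} (t : ℕ) (htm : t ≤ m)
    (Y : Matrix (Fin m) (Fin n) L) (τ : Fin n ≃ Fin n) (π : Fin m ≃ Fin m) (k : ℕ)
    (h : ∀ (r : Fin t → Fin m) (c : Fin t → Fin n), Function.Injective r → Function.Injective c →
      (Y.submatrix r c).det = 0) : levelSum t Y τ π k = 0 := by
  unfold levelSum
  refine Finset.sum_eq_zero fun e he => ?_
  simp only [Finset.mem_filter, Finset.mem_univ, true_and] at he
  by_contra hne
  rw [← ne_eq, aux_cols] at hne
  let c0 : Fin t → Fin n := fun k => ⟨e (Fin.castLE htm k), he.1 _ k.2⟩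
  have hc0 : Function.Injective c0 := by
    intro x y hxy
    have h1 : (e (Fin.castLE htm x) : ℕ) = e (Fin.castLE htm y) := by simpa [c0] using hxy
    exact Fin.castLE_injective htm (e.injective (Fin.ext h1))
  have h1 : LinearIndependent L ((extMat Y τ π).col ∘ e ∘ Fin.castLE htm) :=
    hne.comp _ (Fin.castLE_injective htm)
  have h2 : (extMat Y τ π).col ∘ e ∘ Fin.castLE htm = (Y.submatrix id (τ ∘ c0)).col := by
    funext k i
    have : e (Fin.castLE htm k) = Fin.castAdd m (c0 k) := by ext; simp [c0]
    change extMat Y τ π i (e (Fin.castLE htm k)) = Y i (τ (c0 k))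
    rw [this]
    simp [extMat]
  rw [h2] at h1
  obtain ⟨r, hr, hdet⟩ := aux_minor _ h1
  exact hdet (h r (τ ∘ c0) hr (τ.injective.comp hc0))

lemma aux_strict {m M : ℕ} (u : Fin m ↪o Fin M) (d : ℕ) : ∀ i j : Fin m, (j : ℕ) = i + d →
    (u i : ℕ) + d ≤ u j := by
  induction d with
  | zero => intro i j h; have : i = j := by ext; omega
            rw [this]; simp
  | succ d ih =>
    intro i j h
    have hj := j.2
    have h1 := ih i ⟨i + d, by omega⟩ rfl
    have h2 : u ⟨i + d, by omega⟩ < u j := u.strictMono (by rw [Fin.lt_def]; simp; omega)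
    rw [Fin.lt_def] at h2
    omega

lemma aux_sum (m n t : ℕ) (htm : t ≤ m) (htn : t ≤ n) :
    ∑ i : Fin m, (if (i : ℕ) < t then n - t + i else n + i) =
      (m * n - t ^ 2) + ∑ i : Fin m, (i : ℕ) := by
  obtain ⟨d, rfl⟩ := Nat.exists_eq_add_of_le htm
  obtain ⟨c, rfl⟩ := Nat.exists_eq_add_of_le htn
  have h1 : ∑ i : Fin (t + d), (if (i : ℕ) < t then t + c - t + i else t + c + i) =
      ∑ i : Fin (t + d), (if (i : ℕ) < t then c else t + c) + ∑ i : Fin (t + d), (i : ℕ) := by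
    rw [← Finset.sum_add_distrib]
    refine Finset.sum_congr rfl fun i _ => ?_
    split_ifs <;> omega
  rw [h1, Fin.sum_univ_add]
  simp
  have : (t + d) * (t + c) = t * c + d * (t + c) + t ^ 2 := by ring
  omega

lemma aux_main {L : Type*} [Field L] {m n t : ℕ} (htm : t ≤ m) (htn : t ≤ n)
    (Y : Matrix (Fin m) (Fin n) L) (τ : Fin n ≃ Fin n) (π : Fin m ≃ Fin m)
    (hf : ∀ k < m * n - t ^ 2, levelSum t Y τ π k = 0)
    (r : Fin t → Fin m) (c : Fin t → Fin n) (hdet : (Y.submatrix r c).det ≠ 0)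
    (i : Fin m) (j : Fin n) (hij : ¬ ((π.symm i : ℕ) < t) ∨ ¬ (n - t ≤ (τ.symm j : ℕ))) :
    Y i j = 0 := by
  classical
  set a : Fin (n + m) → (Fin m → L) := (extMat Y τ π).col with ha
  have aL : ∀ j, a (Fin.castAdd m j) = Y.col (τ j) := by
    intro j; funext i; simp [ha, extMat, Matrix.col, Matrix.transpose]
  have aR : ∀ l, a (Fin.natAdd n l) = Pi.single (π l) 1 := by
    intro j; funext i; simp [ha, extMat, Matrix.col, Matrix.transpose, Pi.single_apply]
  have hspan : span L (Set.range a) = ⊤ := by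
    rw [eq_top_iff, ← (Pi.basisFun L (Fin m)).span_eq, span_le]
    rintro _ ⟨l, rfl⟩
    apply subset_span
    exact ⟨Fin.natAdd n (π.symm l), by rw [aR]; simp⟩
  obtain ⟨u, hu1, hu2⟩ := aux_greedy (L := L) (m := m) (by simp) a hspan
  have hcond : ∀ i : Fin m, (i : ℕ) < t → (u i : ℕ) < n := by
    intro i hi
    by_contra hn
    have := aux_gale a u hu2 (q := t) (fun k => Fin.castAdd m (τ.symm (c k))) (by
      have := aux_indep Y r c hdet
      have h2 : a ∘ (fun k => Fin.castAdd m (τ.symm (c k))) = Y.col ∘ c := by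
        funext k
        change a (Fin.castAdd m (τ.symm (c k))) = Y.col (c k)
        rw [aL, Equiv.apply_symm_apply]
      rw [h2]
      exact this) i (by
      intro k
      rw [Fin.lt_def]
      simp only [Fin.val_castAdd]
      omega)
    omega
  have hlow : ∀ i : Fin m, (i : ℕ) ≤ u i := by
    intro i
    have hi := i.2
    have := aux_strict u i ⟨0, by omega⟩ i (by simp)
    omega
  have hup : ∀ i : Fin m, (u i : ℕ) ≤ if (i : ℕ) < t then n - t + i else n + i := by
    intro i
    have hi := i.2
    split_ifs with h
    · have h1 := aux_strict u (t - 1 - i) i ⟨t - 1, by omega⟩ (by simp; omega)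
      have h2 := hcond ⟨t - 1, by omega⟩ (by simp; omega)
      omega
    · have h1 := aux_strict u (m - 1 - i) i ⟨m - 1, by omega⟩ (by simp; omega)
      have h2 := (u ⟨m - 1, by omega⟩).2
      omega
  have hS1 : ∑ i : Fin m, (i : ℕ) ≤ ∑ i, (u i : ℕ) := Finset.sum_le_sum fun i _ => hlow i
  have hS2 : m * n - t ^ 2 ≤ ∑ i, (u i : ℕ) - ∑ i : Fin m, (i : ℕ) := by
    by_contra hlt
    push Not at hlt
    have h0 := hf _ hlt
    unfold levelSum at h0
    rw [Finset.sum_eq_single u] at h0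
    · exact ((aux_cols _ _).2 hu1) h0
    · intro e he hne
      simp only [Finset.mem_filter, Finset.mem_univ, true_and] at he
      by_contra hd
      have hle := aux_gale' a u hu2 e ((aux_cols _ _).1 hd)
      apply hne
      have hsum : ∑ i, (u i : ℕ) = ∑ i, (e i : ℕ) := by omega
      have := (Finset.sum_eq_sum_iff_of_le (fun i _ => Fin.le_def.1 (hle i))).1 hsum
      ext i
      exact (this i (Finset.mem_univ _)).symm
    · intro hnot
      exfalso
      apply hnot
      simp only [Finset.mem_filter, Finset.mem_univ, true_and]
      exact ⟨hcond, by omega⟩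
  have hub : ∀ i : Fin m, (u i : ℕ) = if (i : ℕ) < t then n - t + i else n + i := by
    have h1 := aux_sum m n t htm htn
    have h2 := Finset.sum_le_sum (s := Finset.univ) fun i _ => hup i
    have h3 : ∑ i, (u i : ℕ) = ∑ i : Fin m, (if (i : ℕ) < t then n - t + i else n + i) := by omega
    intro i
    exact (Finset.sum_eq_sum_iff_of_le (fun i _ => hup i)).1 h3 i (Finset.mem_univ _)
  by_cases hj : n - t ≤ (τ.symm j : ℕ)
  swap
  · have h1 := hu2 (Fin.castAdd m (τ.symm j))
    have h2 : {k | u k ≤ Fin.castAdd m (τ.symm j)} = ∅ := by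
      ext k
      simp only [Set.mem_ofPred_eq, Set.mem_empty_iff_false, iff_false]
      rw [Fin.le_def]
      simp only [Fin.val_castAdd]
      have := hub k
      split_ifs at this <;> omega
    rw [h2, Set.image_empty, span_empty, mem_bot, aL] at h1
    simpa [Matrix.col, Matrix.transpose] using congrFun h1 i
  · have hi : ¬ ((π.symm i : ℕ) < t) := by tauto
    let v : Fin t → (Fin m → L) := fun l => Pi.single (π (Fin.castLE htm l)) 1
    let w : Fin t → (Fin m → L) := fun l => a (u (Fin.castLE htm l))
    have hv : LinearIndependent L v := by
      have := (Pi.basisFun L (Fin m)).linearIndependent.comp (π ∘ Fin.castLE htm)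
        (π.injective.comp (Fin.castLE_injective htm))
      convert this using 1
      funext l
      simp [v]
    have hvw : span L (Set.range v) ≤ span L (Set.range w) := by
      rw [span_le]
      rintro _ ⟨l, rfl⟩
      have h1 := hu2 (Fin.natAdd n (Fin.castLE htm l))
      rw [aR] at h1
      refine span_mono ?_ h1
      rintro _ ⟨k, hk, rfl⟩
      have hk' : k.1 < t := by
        simp only [Set.mem_ofPred_eq, Fin.le_def, Fin.val_natAdd, Fin.val_castLE] at hk
        have := hub k
        have := l.2
        split_ifs at * <;> omega
      exact ⟨⟨k, hk'⟩, rfl⟩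
    have heq : span L (Set.range v) = span L (Set.range w) := by
      apply Submodule.eq_of_le_of_finrank_le hvw
      rw [finrank_span_eq_card hv]
      exact finrank_range_le_card w
    have hker : span L (Set.range v) ≤ LinearMap.ker (LinearMap.proj (R := L) (φ := fun _ => L) i) := by
      rw [span_le]
      rintro _ ⟨l, rfl⟩
      simp only [SetLike.mem_coe, LinearMap.mem_ker, LinearMap.proj_apply, v]
      rw [Pi.single_apply, if_neg]
      rintro rfl
      apply hi
      simp
    have hmem : Y.col j ∈ span L (Set.range v) := by
      rw [heq]
      apply subset_span
      have hj2 := (τ.symm j).2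
      refine ⟨⟨τ.symm j - (n - t), by omega⟩, ?_⟩
      have : u (Fin.castLE htm ⟨τ.symm j - (n - t), by omega⟩) = Fin.castAdd m (τ.symm j) := by
        ext
        rw [hub, if_pos (by simp; omega)]
        simp; omega
      simp only [w]
      rw [this, aL]; simp
    exact hker hmem

/-- If there exist `t` rows and `t` columns of `X` such that the entries of `X` lying
outside the corresponding `t × t` submatrix are algebraically dependent over the
algebraically closed field `K`, then `ara I_t(X) ≤ mn - t²`. -/
theorem stmt1 {K : Type*} [Field K] [IsAlgClosed K] (N m n t : ℕ)
    (X : Matrix (Fin m) (Fin n) (MvPolynomial (Fin N) K))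
    (hmn : m ≤ n) (ht1 : 1 ≤ t) (htm : t ≤ m) (htn : t < n)
    (hdep : ∃ (ρ : Fin t → Fin m) (σ : Fin t → Fin n),
      Function.Injective ρ ∧ Function.Injective σ ∧
      ∃ F : MvPolynomial {p : Fin m × Fin n // p.1 ∉ Set.range ρ ∨ p.2 ∉ Set.range σ} K,
        F ≠ 0 ∧ MvPolynomial.aeval (fun p => X p.1.1 p.1.2) F = 0) :
    araRank (minorsIdeal t X) ≤ m * n - t ^ 2 := by
  classical
  obtain ⟨ρ, σ, hρ, hσ, F, hF, hFX⟩ := hdep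
  have : Infinite K := IsAlgClosed.instInfinite
  set δ := (X.submatrix ρ σ).det with hδ
  obtain ⟨p, hp⟩ := aux_dep _ F hF hFX δ
  obtain ⟨π, hπ⟩ := aux_perm (fun l : Fin m => (l : ℕ) < t) (fun i => i ∈ Set.range ρ) (by
    have h1 : Nat.card {x // x ∈ Set.range ρ} = t := by
      exact (Nat.card_congr (Equiv.ofInjective ρ hρ)).symm.trans (by simp)
    rw [h1, Nat.card_eq_fintype_card, Fintype.card_subtype]
    simp [Fin.card_filter_val_lt, htm])
  obtain ⟨τ, hτ⟩ := aux_perm (fun l : Fin n => n - t ≤ (l : ℕ)) (fun i => i ∈ Set.range σ) (by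
    have h1 : Nat.card {x // x ∈ Set.range σ} = t := by
      exact (Nat.card_congr (Equiv.ofInjective σ hσ)).symm.trans (by simp)
    rw [h1, Nat.card_eq_fintype_card, Fintype.card_subtype]
    have h2 := Finset.card_filter_add_card_filter_not (s := (Finset.univ : Finset (Fin n)))
      (fun l : Fin n => (l : ℕ) < n - t)
    simp only [Fin.card_filter_val_lt, not_lt, Finset.card_univ, Fintype.card_fin] at h2
    omega)
  let P : Matrix (Fin m) (Fin n) (MvPolynomial (Fin N) K) := fun i j =>
    if h : i ∉ Set.range ρ ∨ j ∉ Set.range σ then p ⟨(i, j), h⟩ else 0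
  let X' : Matrix (Fin m) (Fin n) (MvPolynomial (Fin N) K) := fun i j => X i j - δ * P i j
  have hblock : X'.submatrix ρ σ = X.submatrix ρ σ := by
    ext1 i j
    have : P (ρ i) (σ j) = 0 := by simp [P]
    change X (ρ i) (σ j) - δ * P (ρ i) (σ j) = X (ρ i) (σ j)
    rw [this]; simp
  apply Nat.sInf_le
  refine ⟨fun k => levelSum t X' τ π k, ?_⟩
  have hmain : ∀ I : Ideal (MvPolynomial (Fin N) K), I.IsPrime →
      (Ideal.span (Set.range fun k : Fin (m * n - t ^ 2) => levelSum t X' τ π k) ≤ I ↔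
        minorsIdeal t X ≤ I) := by
    intro I hI
    let φ := algebraMap (MvPolynomial (Fin N) K) I.ResidueField
    have hφ : ∀ x, φ x = 0 ↔ x ∈ I := fun x => Ideal.algebraMap_residueField_eq_zero
    have hdetφ : ∀ (Z : Matrix (Fin m) (Fin n) (MvPolynomial (Fin N) K)) (r : Fin t → Fin m)
        (c : Fin t → Fin n), φ (Z.submatrix r c).det = ((Z.map φ).submatrix r c).det := by
      intro Z r c
      rw [RingHom.map_det]; rfl
    have hXX : φ δ = 0 → X'.map φ = X.map φ := by
      intro h
      ext i j
      change φ (X i j - δ * P i j) = φ (X i j)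
      simp [h]
    have hmin : minorsIdeal t X ≤ I ↔ ∀ (r : Fin t → Fin m) (c : Fin t → Fin n),
        Function.Injective r → Function.Injective c → ((X.map φ).submatrix r c).det = 0 := by
      unfold minorsIdeal
      rw [Ideal.span_le]
      constructor
      · intro h r c hr hc
        rw [← hdetφ, hφ]
        exact h ⟨r, c, hr, hc, rfl⟩
      · rintro h _ ⟨r, c, hr, hc, rfl⟩
        have := h r c hr hc
        rw [← hdetφ, hφ] at this
        exact this
    rw [hmin, Ideal.span_le]
    constructor
    · intro h
      have hf : ∀ k < m * n - t ^ 2, levelSum t (X'.map φ) τ π k = 0 := by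
        intro k hk
        rw [← levelSum_map, hφ]
        exact h ⟨⟨k, hk⟩, rfl⟩
      have hall : ∀ (r : Fin t → Fin m) (c : Fin t → Fin n),
        Function.Injective r → Function.Injective c → ((X'.map φ).submatrix r c).det = 0 := by
        intro r c hr hc
        by_contra hdet
        have hz : ∀ i j, (i ∉ Set.range ρ ∨ j ∉ Set.range σ) → X'.map φ i j = 0 := by
          intro i j hij
          refine aux_main htm htn.le _ τ π hf r c hdet i j ?_
          rw [← hπ, ← hτ]
          simpa using hij
        have hδ0 : φ δ = 0 := by
          apply hp
          rintro ⟨⟨i, j⟩, hij⟩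
          have := hz i j hij
          change φ (X i j - δ * P i j) = 0 at this
          have hP : P i j = p ⟨(i, j), hij⟩ := dif_pos hij
          rw [hP] at this
          exact this
        have hr' : ∀ k, ∃ l, ρ l = r k := by
          intro k
          by_contra hk
          exact hdet (Matrix.det_eq_zero_of_row_eq_zero k (fun l => hz _ _ (Or.inl hk)))
        have hc' : ∀ k, ∃ l, σ l = c k := by
          intro k
          by_contra hk
          exact hdet (Matrix.det_eq_zero_of_column_eq_zero k (fun l => hz _ _ (Or.inr hk)))
        choose a ha using hr'
        choose b hb using hc'
        have hainj : Function.Injective a := fun x y hxy => hr (by rw [← ha, ← ha, hxy])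
        have hbinj : Function.Injective b := fun x y hxy => hc (by rw [← hb, ← hb, hxy])
        let ea := Equiv.ofBijective a (Finite.injective_iff_bijective.1 hainj)
        let eb := Equiv.ofBijective b (Finite.injective_iff_bijective.1 hbinj)
        have h1 : (X'.map φ).submatrix r c = ((X'.map φ).submatrix ρ σ).submatrix ea eb := by
          ext i j
          simp [ea, eb, ha, hb]
        have h2 : IsUnit ((X'.map φ).submatrix r c) := by
          rw [Matrix.isUnit_iff_isUnit_det]; exact (Ne.isUnit hdet)
        rw [h1, Matrix.isUnit_submatrix_equiv, Matrix.isUnit_iff_isUnit_det, ← hdetφ, hblock, ← hδ,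
          hδ0] at h2
        exact not_isUnit_zero h2
      have hδ0 : φ δ = 0 := by
        rw [hδ, ← hblock, hdetφ]
        exact hall ρ σ hρ hσ
      rw [← hXX hδ0]
      exact hall
    · rintro h _ ⟨k, rfl⟩
      have hδ0 : φ δ = 0 := by
        rw [hδ, hdetφ]
        exact h ρ σ hρ hσ
      rw [SetLike.mem_coe, ← hφ, levelSum_map, hXX hδ0]
      exact levelSum_zero t htm _ τ π _ h
  rw [Ideal.radical_eq_sInf, Ideal.radical_eq_sInf]
  congr 1
  ext I
  constructor
  · rintro ⟨h1, h2⟩; exact ⟨(hmain I h2).1 h1, h2⟩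
  · rintro ⟨h1, h2⟩; exact ⟨(hmain I h2).2 h1, h2⟩
end

section
/- Let K be an algebraically closed field, R = K[x_1,…,x_N] a polynomial ring over K, and X an (m×n)-matrix with entries in R, where m ≤ n. Let t be an integer with 1 ≤ t ≤ m and t < n. If some entry of X is zero, then ara I_t(X) ≤ mn − t². -/
section vec
variable {L V : Type*} [Field L] [AddCommGroup V] [Module L V] [FiniteDimensional L V]
  {m : ℕ} (v : Fin m → V)

theorem finrank_span_image_card {v : Fin m → V} {I : Finset (Fin m)}
    (h : LinearIndepOn L v (I : Set (Fin m))) :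
    Module.finrank L (Submodule.span L (v '' (I : Set (Fin m)))) = I.card := by
  have := finrank_span_eq_card h
  rw [Set.image_eq_range]
  simpa using this

theorem card_le_of_indep {v : Fin m → V} {I : Finset (Fin m)}
    (h : LinearIndepOn L v (I : Set (Fin m))) :
    I.card ≤ Module.finrank L (Submodule.span L (Set.range v)) := by
  rw [← finrank_span_image_card h]
  exact Submodule.finrank_mono (Submodule.span_mono (Set.image_subset_range _ _))

theorem extend_base {v : Fin m → V} {I : Finset (Fin m)}
    (h : LinearIndepOn L v (I : Set (Fin m))) :
    ∃ I2 : Finset (Fin m), I ⊆ I2 ∧ LinearIndepOn L v (I2 : Set (Fin m)) ∧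
      I2.card = Module.finrank L (Submodule.span L (Set.range v)) := by
  classical
  obtain ⟨b, -, hb, hs, hl⟩ := exists_linearIndepOn_extension h (Set.subset_univ _)
  have hbb : ((b.toFinset : Finset (Fin m)) : Set (Fin m)) = b := by simp
  refine ⟨b.toFinset, ?_, by rw [hbb]; exact hl, ?_⟩
  · rw [← Finset.coe_subset, hbb]; exact hb
  · apply le_antisymm
    · apply card_le_of_indep (by rw [hbb]; exact hl)
    · rw [← finrank_span_image_card (L := L) (v := v) (I := b.toFinset) (by rw [hbb]; exact hl), hbb]
      apply Submodule.finrank_mono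
      rw [Submodule.span_le]
      simpa using hs

theorem exchange_base {v : Fin m → V} {I I' : Finset (Fin m)}
    (h : LinearIndepOn L v (I : Set (Fin m)))
    (h' : LinearIndepOn L v (I' : Set (Fin m))) (hc : I.card = I'.card)
    {e : Fin m} (he : e ∈ I) :
    ∃ f ∈ I', f ∉ I.erase e ∧ LinearIndepOn L v ((insert f (I.erase e) : Finset (Fin m)) : Set (Fin m)) := by
  have h1 : LinearIndepOn L v ((I.erase e : Finset (Fin m)) : Set (Fin m)) :=
    h.mono (by simp)
  by_contra hcon
  have : Submodule.span L (v '' (I' : Set (Fin m))) ≤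
      Submodule.span L (v '' ((I.erase e : Finset (Fin m)) : Set (Fin m))) := by
    rw [Submodule.span_le]
    rintro _ ⟨f, hf, rfl⟩
    by_contra hfn
    apply hcon
    refine ⟨f, hf, fun hfe => hfn (Submodule.subset_span ⟨f, hfe, rfl⟩), ?_⟩
    rw [Finset.coe_insert]
    exact h1.insert hfn
  have := Submodule.finrank_mono this
  rw [finrank_span_image_card h', finrank_span_image_card h1, Finset.card_erase_of_mem he] at this
  have : 0 < I.card := Finset.card_pos.2 ⟨e, he⟩
  omega

theorem max_base_aux {v : Fin m → V} {I I' : Finset (Fin m)}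
    (h : LinearIndepOn L v (I : Set (Fin m)))
    (h' : LinearIndepOn L v (I' : Set (Fin m))) (hc : I.card = I'.card)
    (hmax : ∀ J : Finset (Fin m), LinearIndepOn L v (J : Set (Fin m)) → J.card = I.card →
      ∑ i ∈ J, (i : ℕ) ≤ ∑ i ∈ I, (i : ℕ))
    {e : Fin m} (he : e ∈ I) (he' : e ∉ I') (hmin : ∀ f ∈ I', f ∉ I → e ≤ f) : False := by
  obtain ⟨f, hf, hfe, hl⟩ := exchange_base h h' hc he
  have hne : f ≠ e := fun hh => he' (hh ▸ hf)
  have hfI : f ∉ I := fun hh => hfe (Finset.mem_erase.2 ⟨hne, hh⟩)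
  have hlt : e < f := lt_of_le_of_ne (hmin f hf hfI) hne.symm
  have hle := hmax _ hl (by
    rw [Finset.card_insert_of_notMem hfe, Finset.card_erase_of_mem he]
    have : 0 < I.card := Finset.card_pos.2 ⟨e, he⟩
    omega)
  rw [Finset.sum_insert hfe, ← Finset.add_sum_erase I _ he] at hle
  have : (e : ℕ) < f := hlt
  omega

theorem max_base_unique {v : Fin m → V} {I I' : Finset (Fin m)}
    (h : LinearIndepOn L v (I : Set (Fin m)))
    (h' : LinearIndepOn L v (I' : Set (Fin m))) (hc : I.card = I'.card)
    (hmax : ∀ J : Finset (Fin m), LinearIndepOn L v (J : Set (Fin m)) → J.card = I.card →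
      ∑ i ∈ J, (i : ℕ) ≤ ∑ i ∈ I, (i : ℕ))
    (hs : ∑ i ∈ I', (i : ℕ) = ∑ i ∈ I, (i : ℕ)) : I' = I := by
  classical
  by_contra hne
  have hn : (symmDiff I' I).Nonempty := by
    rw [Finset.nonempty_iff_ne_empty]
    intro h0
    exact hne (symmDiff_eq_bot.1 h0)
  obtain ⟨e, he, hmin⟩ := Finset.exists_min_image _ id hn
  rcases Finset.mem_symmDiff.1 he with ⟨h1, h2⟩ | ⟨h1, h2⟩
  · refine max_base_aux h' h hc.symm (fun J hJ hJc => by rw [hs]; exact hmax J hJ (hJc.trans hc.symm)) h1 h2 ?_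
    intro f hf hf'
    exact hmin f (Finset.mem_symmDiff.2 (Or.inr ⟨hf, hf'⟩))
  · refine max_base_aux h h' hc hmax h1 h2 ?_
    intro f hf hf'
    exact hmin f (Finset.mem_symmDiff.2 (Or.inl ⟨hf, hf'⟩))

theorem exists_max_base (v : Fin m → V) : ∃ I : Finset (Fin m),
    LinearIndepOn L v (I : Set (Fin m)) ∧
      I.card = Module.finrank L (Submodule.span L (Set.range v)) ∧
    (∀ J : Finset (Fin m), LinearIndepOn L v (J : Set (Fin m)) → J.card = I.card →
      ∑ i ∈ J, (i : ℕ) ≤ ∑ i ∈ I, (i : ℕ)) := by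
  classical
  obtain ⟨I0, -, hI0, hI0c⟩ := extend_base (L := L) (v := v) (I := ∅) (by simp)
  obtain ⟨I, hI, hm⟩ := Finset.exists_max_image
    (Finset.univ.filter (fun I : Finset (Fin m) => LinearIndepOn L v (I : Set (Fin m)) ∧
      I.card = Module.finrank L (Submodule.span L (Set.range v)))) (fun I => ∑ i ∈ I, (i : ℕ))
      ⟨I0, by simp [hI0, hI0c]⟩
  simp only [Finset.mem_filter, Finset.mem_univ, true_and] at hI hm
  exact ⟨I, hI.1, hI.2, fun J hJ hJc => hm J ⟨hJ, hJc.trans hI.2⟩⟩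

end vec

section comb
variable {m n : ℕ}

theorem sum_lower (I : Finset (Fin m)) : I.card * I.card ≤ 2 * ∑ i ∈ I, (i : ℕ) + I.card := by
  have h1 : ∑ i ∈ I, (i : ℕ) = ∑ k : Fin I.card, ((I.orderEmbOfFin rfl k : Fin m) : ℕ) := by
    conv_lhs => rw [← Finset.image_orderEmbOfFin_univ I rfl]
    rw [Finset.sum_image (fun a _ b _ h => (I.orderEmbOfFin rfl).injective h)]
  have h2 : ∀ k : Fin I.card, (k : ℕ) ≤ (I.orderEmbOfFin rfl k : Fin m) := by
    intro ⟨k, hk⟩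
    induction k with
    | zero => simp
    | succ k ih =>
      have := ih (by omega)
      have h3 : I.orderEmbOfFin rfl ⟨k, by omega⟩ < I.orderEmbOfFin rfl ⟨k+1, hk⟩ := by
        simp
      have h4 : ((I.orderEmbOfFin rfl ⟨k, by omega⟩ : Fin m) : ℕ) < (I.orderEmbOfFin rfl ⟨k+1, hk⟩ : Fin m) := h3
      simp only at this ⊢
      omega
  have h3 := Finset.sum_le_sum (fun k (_ : k ∈ (Finset.univ : Finset (Fin I.card))) => h2 k)
  rw [← h1, Fin.sum_univ_eq_sum_range (fun i => i)] at h3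
  have := Finset.sum_range_id_mul_two I.card
  rcases Nat.eq_zero_or_pos I.card with h0 | h0
  · simp [h0]
  · obtain ⟨c, hc⟩ : ∃ c, I.card = c + 1 := ⟨I.card - 1, by omega⟩
    rw [hc] at this h3 ⊢
    simp only [Nat.add_sub_cancel] at this
    nlinarith

theorem sum_upper (I : Finset (Fin m)) :
    I.card * I.card + 2 * ∑ i ∈ I, (i : ℕ) + I.card ≤ 2 * (I.card * m) := by
  have h := sum_lower (I.map Fin.revPerm.toEmbedding)
  rw [Finset.card_map, Finset.sum_map] at h
  have h2 : ∑ i ∈ I, ((Fin.revPerm.toEmbedding i : Fin m) : ℕ) + ∑ i ∈ I, (i : ℕ) + I.card = I.card * m := by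
    rw [← Finset.sum_add_distrib, Finset.card_eq_sum_ones, ← Finset.sum_add_distrib, Finset.sum_mul]
    apply Finset.sum_congr rfl
    intro i _
    simp
    omega
  omega

theorem sum_lower_eq (I : Finset (Fin m)) (h : 2 * ∑ i ∈ I, (i : ℕ) + I.card ≤ I.card * I.card) :
    ∀ i ∈ I, (i : ℕ) < I.card := by
  intro i hi
  have h1 := sum_lower (I.erase i)
  rw [← Finset.add_sum_erase I _ hi] at h
  obtain ⟨c, hc⟩ : ∃ c, I.card = c + 1 := ⟨I.card - 1, by have := Finset.card_pos.2 ⟨i, hi⟩; omega⟩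
  rw [Finset.card_erase_of_mem hi, hc] at h1
  rw [hc] at h ⊢
  simp only [Nat.add_sub_cancel] at h1
  nlinarith

/-- The height of a minor. -/
def mht (I : Finset (Fin m)) (J : Finset (Fin n)) : ℕ :=
  ∑ i ∈ I, (i : ℕ) + ∑ j ∈ J, (j : ℕ) + I.card

theorem mht_le (I : Finset (Fin m)) (J : Finset (Fin n)) (h : J.card = I.card) :
    mht I J ≤ m * n := by
  have h1 := sum_upper I
  have h2 := sum_upper J
  have h3 : I.card ≤ m := by simpa using Finset.card_le_univ I
  have h4 : I.card ≤ n := by rw [← h]; simpa using Finset.card_le_univ J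
  rw [h] at h2
  unfold mht
  obtain ⟨a, ha⟩ := Nat.exists_eq_add_of_le h3
  obtain ⟨b, hb⟩ := Nat.exists_eq_add_of_le h4
  generalize hS : ∑ i ∈ I, (i : ℕ) = S at *
  generalize hT : ∑ j ∈ J, (j : ℕ) = T at *
  generalize I.card = r at *
  subst ha hb
  nlinarith [Nat.zero_le (a * b)]

theorem le_mht (I : Finset (Fin m)) (J : Finset (Fin n)) (h : J.card = I.card) :
    I.card ^ 2 ≤ mht I J := by
  have h1 := sum_lower I
  have h2 := sum_lower J
  rw [h] at h2
  unfold mht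
  nlinarith

theorem mht_eq (I : Finset (Fin m)) (J : Finset (Fin n)) (h : J.card = I.card)
    (he : mht I J ≤ I.card ^ 2) : (∀ i ∈ I, (i : ℕ) < I.card) ∧ (∀ j ∈ J, (j : ℕ) < I.card) := by
  have h1 := sum_lower I
  have h2 := sum_lower J
  have h3 := sum_lower_eq I
  have h4 := sum_lower_eq J
  rw [h] at h2 h4
  unfold mht at he
  rw [sq] at he
  exact ⟨h3 (by omega), h4 (by omega)⟩

end comb

section ring
variable {R : Type*} [CommRing R] {m n : ℕ}

/-- The minor with rows `I` and columns `J`. -/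
def mnr (A : Matrix (Fin m) (Fin n) R) (I : Finset (Fin m)) (J : Finset (Fin n)) : R :=
  if h : J.card = I.card then (A.submatrix (I.orderEmbOfFin rfl) (J.orderEmbOfFin h)).det else 0

/-- Sum of the minors of given height. -/
def lev (t : ℕ) (A : Matrix (Fin m) (Fin n) R) (k : ℕ) : R :=
  ∑ p : Finset (Fin m) × Finset (Fin n) with (t ≤ p.1.card ∧ mht p.1 p.2 = k), mnr A p.1 p.2

theorem map_mnr {S : Type*} [CommRing S] (φ : R →+* S) (A : Matrix (Fin m) (Fin n) R) (I J) :
    φ (mnr A I J) = mnr (A.map φ) I J := by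
  unfold mnr
  split_ifs with h
  · rw [RingHom.map_det]; rfl
  · simp

theorem map_lev {S : Type*} [CommRing S] (φ : R →+* S) (t : ℕ) (A : Matrix (Fin m) (Fin n) R) (k) :
    φ (lev t A k) = lev t (A.map φ) k := by
  unfold lev
  simp [map_sum, map_mnr]

theorem mnr_congr {A B : Matrix (Fin m) (Fin n) R} {I J}
    (h : ∀ i ∈ I, ∀ j ∈ J, A i j = B i j) : mnr A I J = mnr B I J := by
  unfold mnr
  split_ifs with hc
  · congr 1
    ext i j
    exact h _ (Finset.orderEmbOfFin_mem _ _ _) _ (Finset.orderEmbOfFin_mem _ _ _)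
  · rfl

theorem minorsIdeal_succ_le (t : ℕ) (A : Matrix (Fin m) (Fin n) R) :
    minorsIdeal (t+1) A ≤ minorsIdeal t A := by
  unfold minorsIdeal
  rw [Ideal.span_le]
  rintro _ ⟨r, c, hr, hc, rfl⟩
  rw [Matrix.det_succ_row_zero]
  apply Ideal.sum_mem
  intro j _
  apply Ideal.mul_mem_left
  apply Ideal.subset_span
  exact ⟨r ∘ Fin.succ, c ∘ j.succAbove, hr.comp (Fin.succ_injective _),
    hc.comp Fin.succAbove_right_injective, rfl⟩

theorem minorsIdeal_anti {s t : ℕ} (h : t ≤ s) (A : Matrix (Fin m) (Fin n) R) :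
    minorsIdeal s A ≤ minorsIdeal t A := by
  induction s, h using Nat.le_induction with
  | base => exact le_rfl
  | succ s _ ih => exact (minorsIdeal_succ_le s A).trans ih

theorem mnr_mem {t : ℕ} (A : Matrix (Fin m) (Fin n) R) (I J) (h : t ≤ I.card) :
    mnr A I J ∈ minorsIdeal t A := by
  unfold mnr
  split_ifs with hc
  · apply minorsIdeal_anti h
    exact Ideal.subset_span ⟨_, _, (I.orderEmbOfFin rfl).injective, (J.orderEmbOfFin hc).injective, rfl⟩
  · exact zero_mem _

theorem minorsIdeal_submatrix_le (t : ℕ) (A : Matrix (Fin m) (Fin n) R)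
    (σ : Equiv.Perm (Fin m)) (τ : Equiv.Perm (Fin n)) :
    minorsIdeal t (A.submatrix σ τ) ≤ minorsIdeal t A := by
  unfold minorsIdeal
  apply Ideal.span_mono
  rintro _ ⟨r, c, hr, hc, rfl⟩
  exact ⟨σ ∘ r, τ ∘ c, σ.injective.comp hr, τ.injective.comp hc, rfl⟩

theorem minorsIdeal_submatrix (t : ℕ) (A : Matrix (Fin m) (Fin n) R)
    (σ : Equiv.Perm (Fin m)) (τ : Equiv.Perm (Fin n)) :
    minorsIdeal t (A.submatrix σ τ) = minorsIdeal t A := by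
  apply le_antisymm (minorsIdeal_submatrix_le _ _ _ _)
  have := minorsIdeal_submatrix_le t (A.submatrix σ τ) σ.symm τ.symm
  simpa using this

/-- Index set of the first `t` elements. -/
def ini (m t : ℕ) : Finset (Fin m) := Finset.univ.filter (fun i => (i : ℕ) < t)

/-- The leading minor. -/
def ldm (t : ℕ) (A : Matrix (Fin m) (Fin n) R) : R := mnr A (ini m t) (ini n t)

/-- Matrix modified at one entry by the leading minor. -/
def modi (t : ℕ) (A : Matrix (Fin m) (Fin n) R) (i : Fin m) (j : Fin n) :
    Matrix (Fin m) (Fin n) R := A + Matrix.single i j (ldm t A)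

theorem map_modi {S : Type*} [CommRing S] (φ : R →+* S) (t : ℕ) (A : Matrix (Fin m) (Fin n) R) (i j) :
    (modi t A i j).map φ = modi t (A.map φ) i j := by
  unfold modi ldm
  rw [← map_mnr]
  ext a b
  simp [Matrix.single_apply, apply_ite φ]

theorem card_ini {m t : ℕ} (h : t ≤ m) : (ini m t).card = t := by
  unfold ini
  rw [Fin.card_filter_val_lt]; omega

theorem eq_ini {I : Finset (Fin m)} (h : ∀ i ∈ I, (i : ℕ) < I.card) : I = ini m I.card := by
  apply Finset.eq_of_subset_of_card_le
  · intro i hi; simp [ini, h i hi]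
  · rw [card_ini]; simpa using Finset.card_le_univ I

end ring

section field
variable {L : Type*} [Field L] {m n : ℕ}

theorem rows_indep_of_det {t : ℕ} {A : Matrix (Fin m) (Fin n) L} {r : Fin t → Fin m}
    {c : Fin t → Fin n} (h : (A.submatrix r c).det ≠ 0) : LinearIndependent L (A.row ∘ r) := by
  have h1 : LinearIndependent L (A.submatrix r c).row :=
    Matrix.linearIndependent_rows_of_det_ne_zero h
  exact LinearIndependent.of_comp (LinearMap.funLeft L L c) h1

theorem indepOn_of_comp {V : Type*} [AddCommGroup V] [Module L V] {v : Fin m → V}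
    {I : Finset (Fin m)} {k : ℕ} (hk : I.card = k) :
    LinearIndependent L (v ∘ I.orderEmbOfFin hk) ↔ LinearIndepOn L v (I : Set (Fin m)) := by
  have := linearIndependent_equiv (R := L) (I.orderIsoOfFin hk).toEquiv (f := fun i : I => v i)
  exact this

theorem mnr_ne {A : Matrix (Fin m) (Fin n) L} {I J} (h : mnr A I J ≠ 0) :
    J.card = I.card ∧ LinearIndepOn L A.row (I : Set (Fin m)) ∧
      LinearIndepOn L A.col (J : Set (Fin n)) := by
  unfold mnr at h
  split_ifs at h with hc
  · refine ⟨hc, (indepOn_of_comp rfl).1 (rows_indep_of_det h), ?_⟩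
    rw [← Matrix.det_transpose, Matrix.transpose_submatrix] at h
    exact (indepOn_of_comp hc).1 (rows_indep_of_det h)
  · exact absurd rfl h

theorem ne_mnr {A : Matrix (Fin m) (Fin n) L} {I : Finset (Fin m)} {J : Finset (Fin n)} (hI : LinearIndepOn L A.row (I : Set (Fin m)))
    (hJ : LinearIndepOn L A.col (J : Set (Fin n))) (hIc : I.card = A.rank) (hJc : J.card = A.rank) :
    mnr A I J ≠ 0 := by
  have hc : J.card = I.card := by omega
  unfold mnr
  rw [dif_pos hc]
  have hspan : Submodule.span L (Set.range (A.col ∘ J.orderEmbOfFin hc)) =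
      Submodule.span L (Set.range A.col) := by
    apply Submodule.eq_of_le_of_finrank_eq
    · exact Submodule.span_mono (Set.range_comp_subset_range _ _)
    · rw [finrank_span_eq_card ((indepOn_of_comp hc).2 hJ), ← Matrix.rank_eq_finrank_span_cols]
      simpa using hIc
  have hM : ∀ j, ∃ u : Fin I.card → L, ∑ k, u k • (A.col ∘ J.orderEmbOfFin hc) k = A.col j := by
    intro j
    rw [← Submodule.mem_span_range_iff_exists_fun, hspan]
    exact Submodule.subset_span ⟨j, rfl⟩
  choose u hu using hM
  have hmul : A.submatrix (I.orderEmbOfFin rfl) id =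
      A.submatrix (I.orderEmbOfFin rfl) (J.orderEmbOfFin hc) * Matrix.of (fun k j => u j k) := by
    ext i j
    have := congrFun (hu j) (I.orderEmbOfFin rfl i)
    simp only [Matrix.submatrix_apply, id, Matrix.mul_apply, Matrix.of_apply]
    simp only [Finset.sum_apply, Pi.smul_apply, Function.comp, Matrix.col_apply, smul_eq_mul] at this
    rw [← this]
    exact Finset.sum_congr rfl (fun k _ => mul_comm _ _)
  have hr : (A.submatrix (I.orderEmbOfFin rfl) id).rank = I.card := by
    have : LinearIndependent L (A.submatrix (I.orderEmbOfFin rfl) id).row :=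
      (indepOn_of_comp rfl).2 hI
    simpa using this.rank_matrix
  have h2 := Matrix.rank_mul_le_left (A.submatrix (I.orderEmbOfFin rfl) (J.orderEmbOfFin hc))
    (Matrix.of (fun k j => u j k))
  rw [← hmul, hr] at h2
  have h3 : LinearIndependent L (A.submatrix (I.orderEmbOfFin rfl) (J.orderEmbOfFin hc)).row := by
    rw [linearIndependent_iff_card_le_finrank_span, Set.finrank,
      ← Matrix.rank_eq_finrank_span_row]
    simpa using h2
  rw [Matrix.linearIndependent_rows_iff_isUnit, Matrix.isUnit_iff_isUnit_det] at h3
  exact h3.ne_zero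

theorem key {t : ℕ} (A : Matrix (Fin m) (Fin n) L) (hr : t ≤ A.rank)
    (hF : ∀ k, t ^ 2 < k → k ≤ m * n → lev t A k = 0) :
    mnr A (ini m t) (ini n t) ≠ 0 ∧ ∀ (i : Fin m) (j : Fin n), t ≤ (j : ℕ) → A i j = 0 := by
  classical
  obtain ⟨I, hI, hIc, hIm⟩ := exists_max_base (L := L) A.row
  obtain ⟨J, hJ, hJc, hJm⟩ := exists_max_base (L := L) A.col
  rw [← Matrix.rank_eq_finrank_span_row] at hIc
  rw [← Matrix.rank_eq_finrank_span_cols] at hJc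
  have hc : J.card = I.card := by omega
  have hne := ne_mnr hI hJ hIc hJc
  have hmax : ∀ I' J', mnr A I' J' ≠ 0 → mht I' J' ≤ mht I J ∧ (mht I J ≤ mht I' J' → I' = I ∧ J' = J) := by
    intro I' J' h
    obtain ⟨h1, h2, h3⟩ := mnr_ne h
    obtain ⟨I2, hI2, hI2l, hI2c⟩ := extend_base h2
    obtain ⟨J2, hJ2, hJ2l, hJ2c⟩ := extend_base h3
    rw [← Matrix.rank_eq_finrank_span_row] at hI2c
    rw [← Matrix.rank_eq_finrank_span_cols] at hJ2c
    have a1 := hIm I2 hI2l (by omega)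
    have a2 := hJm J2 hJ2l (by omega)
    have a3 : ∑ i ∈ I', (i : ℕ) ≤ ∑ i ∈ I2, (i : ℕ) := Finset.sum_le_sum_of_subset hI2
    have a4 : ∑ i ∈ J', (i : ℕ) ≤ ∑ i ∈ J2, (i : ℕ) := Finset.sum_le_sum_of_subset hJ2
    have a5 := Finset.card_le_card hI2
    unfold mht
    refine ⟨by omega, fun hh => ?_⟩
    have b1 : I' = I2 := Finset.eq_of_subset_of_card_le hI2 (by omega)
    have b2 : J' = J2 := Finset.eq_of_subset_of_card_le hJ2 (by omega)
    subst b1 b2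
    exact ⟨max_base_unique hI h2 (by omega) hIm (by omega),
      max_base_unique hJ h3 (by omega) hJm (by omega)⟩
  have hlev : lev t A (mht I J) = mnr A I J := by
    unfold lev
    rw [Finset.sum_eq_single (I, J)]
    · rintro ⟨I', J'⟩ hb hb'
      by_contra h
      simp only [Finset.mem_filter, Finset.mem_univ, true_and] at hb
      obtain ⟨e1, e2⟩ := (hmax I' J' h).2 hb.2.ge
      exact hb' (by rw [e1, e2])
    · intro h
      exfalso
      apply h
      simp only [Finset.mem_filter, Finset.mem_univ, true_and, and_true]
      omega
  have hle : mht I J ≤ t ^ 2 := by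
    by_contra h
    exact hne (hlev ▸ hF _ (by omega) (mht_le I J hc))
  have hge := le_mht I J hc
  have hIt : I.card = t := by
    have : I.card ^ 2 ≤ t ^ 2 := hge.trans hle
    have := (Nat.pow_le_pow_iff_left (two_ne_zero)).1 this
    omega
  obtain ⟨c1, c2⟩ := mht_eq I J hc (by rw [hIt]; exact hle)
  have e1 := eq_ini c1
  have e2 := eq_ini (I := J) (by rw [hc]; exact c2)
  rw [hc] at e2
  rw [hIt] at e1 e2
  refine ⟨by rw [← e1, ← e2]; exact hne, ?_⟩
  intro i j hj
  by_contra hij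
  have hcol : A.col j ≠ 0 := fun h => hij (congrFun h i)
  obtain ⟨J2, hJ2, hJ2l, hJ2c⟩ := extend_base (L := L) (v := A.col) (I := {j}) (by
    rw [Finset.coe_singleton]; exact LinearIndepOn.singleton hcol)
  rw [← Matrix.rank_eq_finrank_span_cols] at hJ2c
  have h5 := (hmax I J2 (ne_mnr hI hJ2l hIc hJ2c)).1
  have h6 := (mht_eq I J2 (by omega) (by rw [hIt]; exact h5.trans hle)).2 j (hJ2 (by simp))
  omega

theorem field_main {t : ℕ} (A : Matrix (Fin m) (Fin n) L) (i : Fin m) (j : Fin n)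
    (hj : t ≤ (j : ℕ)) (htm : t ≤ m) (hz : A i j = 0) :
    (∀ k, t ^ 2 < k → k ≤ m * n → lev t (modi t A i j) k = 0) ↔ minorsIdeal t A = ⊥ := by
  have h0 : ldm t A = 0 → modi t A i j = A := by
    intro h; unfold modi; rw [h]; simp
  constructor
  · intro hF
    have hr : (modi t A i j).rank < t := by
      by_contra hr
      obtain ⟨h1, h2⟩ := key _ (not_lt.1 hr) hF
      have h3 := h2 i j hj
      have h4 : ldm t A = 0 := by simpa [modi, hz] using h3
      rw [h0 h4] at h1
      exact h1 h4
    have hl : ldm t A = 0 := by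
      have : ldm t A = mnr (modi t A i j) (ini m t) (ini n t) := by
        unfold ldm
        apply mnr_congr
        intro a _ b hb
        simp only [ini, Finset.mem_filter] at hb
        have : j ≠ b := by rintro rfl; omega
        simp [modi, Matrix.single_apply, this]
      rw [this]
      by_contra hne
      have h1 := card_le_of_indep (mnr_ne hne).2.1
      rw [← Matrix.rank_eq_finrank_span_row, card_ini htm] at h1
      omega
    rw [h0 hl] at hr
    unfold minorsIdeal
    rw [Ideal.span_eq_bot]
    rintro _ ⟨r, c, -, -, rfl⟩
    by_contra hne
    have h1 := finrank_span_eq_card (rows_indep_of_det hne)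
    have h2 := Submodule.finrank_mono (Submodule.span_mono (R := L) (Set.range_comp_subset_range r A.row))
    rw [h1, ← Matrix.rank_eq_finrank_span_row, Fintype.card_fin] at h2
    omega
  · intro hb k _ _
    have hz : ∀ I J, t ≤ I.card → mnr A I J = 0 := by
      intro I J h
      have := mnr_mem A I J h
      rwa [hb] at this
    rw [h0 (hz _ _ (by rw [card_ini htm]))]
    unfold lev
    apply Finset.sum_eq_zero
    intro p hp
    simp only [Finset.mem_filter] at hp
    exact hz _ _ hp.2.1

end field

theorem minorsIdeal_map_eq_bot {R S : Type*} [CommRing R] [CommRing S] (φ : R →+* S) {m n : ℕ} (t : ℕ)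
    (A : Matrix (Fin m) (Fin n) R) : minorsIdeal t (A.map φ) = ⊥ ↔ minorsIdeal t A ≤ RingHom.ker φ := by
  unfold minorsIdeal
  rw [Ideal.span_eq_bot, Ideal.span_le]
  constructor
  · rintro h _ ⟨r, c, hr, hc, rfl⟩
    have := h _ ⟨r, c, hr, hc, rfl⟩
    rw [SetLike.mem_coe, RingHom.mem_ker, RingHom.map_det]
    exact this
  · rintro h _ ⟨r, c, hr, hc, rfl⟩
    have := h ⟨r, c, hr, hc, rfl⟩
    rw [SetLike.mem_coe, RingHom.mem_ker, RingHom.map_det] at this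
    exact this

theorem ara_main {R : Type*} [CommRing R] {m n t : ℕ} (A : Matrix (Fin m) (Fin n) R)
    (i : Fin m) (j : Fin n) (hj : t ≤ (j : ℕ)) (htm : t ≤ m) (hz : A i j = 0) :
    araRank (minorsIdeal t A) ≤ m * n - t ^ 2 := by
  apply Nat.sInf_le
  refine ⟨fun k => lev t (modi t A i j) (t ^ 2 + 1 + k), ?_⟩
  rw [Ideal.radical_eq_sInf, Ideal.radical_eq_sInf]
  congr 1
  ext P
  simp only [Set.mem_ofPred_eq]
  apply and_congr_left
  intro hP
  let φ : R →+* FractionRing (R ⧸ P) := (algebraMap (R ⧸ P) (FractionRing (R ⧸ P))).comp (Ideal.Quotient.mk P)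
  have hφ : ∀ x, φ x = 0 ↔ x ∈ P := by
    intro x
    simp only [φ, RingHom.comp_apply]
    rw [IsFractionRing.to_map_eq_zero_iff, Ideal.Quotient.eq_zero_iff_mem]
  have hker : RingHom.ker φ = P := by
    ext x; rw [RingHom.mem_ker, hφ]
  have := field_main (t := t) (A.map φ) i j hj htm (by simp [hz])
  rw [minorsIdeal_map_eq_bot, hker] at this
  rw [← this, Ideal.span_le]
  simp only [← map_modi, ← map_lev, hφ]
  constructor
  · intro h k hk1 hk2
    have := h ⟨⟨k - (t ^ 2 + 1), by omega⟩, rfl⟩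
    simp only at this
    rwa [show t ^ 2 + 1 + (k - (t ^ 2 + 1)) = k by omega] at this
  · rintro h _ ⟨k, rfl⟩
    have := k.2
    exact h _ (by omega) (by omega)

/-- If some entry of `X` is zero, then `ara I_t(X) ≤ mn - t²`. -/
theorem stmt2 {K : Type*} [Field K] [IsAlgClosed K] (N m n t : ℕ)
    (X : Matrix (Fin m) (Fin n) (MvPolynomial (Fin N) K))
    (hmn : m ≤ n) (ht1 : 1 ≤ t) (htm : t ≤ m) (htn : t < n)
    (hzero : ∃ (i : Fin m) (j : Fin n), X i j = 0) :
    araRank (minorsIdeal t X) ≤ m * n - t ^ 2 := by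
  obtain ⟨i, j, hz⟩ := hzero
  rw [← minorsIdeal_submatrix t X (Equiv.refl _) (Equiv.swap ⟨n - 1, by omega⟩ j)]
  exact ara_main _ i ⟨n - 1, by omega⟩ (by simp only; omega) htm (by simp [hz])
end

section
/- Let K be an algebraically closed field, R = K[x_1,…,x_N] a polynomial ring over K, and X an (m×n)-matrix with entries in R, where m ≤ n, and let t be an integer with 1 ≤ t ≤ m. Suppose that for some integer k with 1 ≤ k ≤ min{2t+1, m+n−2t}, exactly k entries of X are zero and these zero entries lie on consecutive antidiagonals starting from the upper-left corner, i.e., their positions can be enumerated as (r_1,s_1),…,(r_k,s_k) (1-based indices) with r_h + s_h ≤ h+1 for every h = 1,…,k. Then ara I_t(X) ≤ mn − t² − k + 1. -/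
open Module in
lemma indep_card_le {K V ι : Type*} [Field K] [AddCommGroup V] [Module K V] [Fintype ι]
    (v : ι → V) (I : Finset ι) (h : LinearIndepOn K v (I : Set ι)) (W : Submodule K V)
    [FiniteDimensional K W]
    (hW : ∀ i ∈ I, v i ∈ W) : I.card ≤ finrank K W := by
  have h2 : LinearIndependent K (fun i : (I : Set ι) => (⟨v i, hW i i.2⟩ : W)) := by
    apply LinearIndependent.of_comp W.subtype
    exact h
  simpa using h2.fintype_card_le_finrank

open Module in
lemma indep_extend {K V ι : Type*} [Field K] [AddCommGroup V] [Module K V] [Fintype ι]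
    (v : ι → V) (I : Finset ι) (h : LinearIndepOn K v (I : Set ι)) :
    ∃ B : Finset ι, I ⊆ B ∧ LinearIndepOn K v (B : Set ι) ∧
      B.card = finrank K (Submodule.span K (Set.range v)) ∧
      Submodule.span K (v '' B) = Submodule.span K (Set.range v) := by
  classical
  obtain ⟨b, -, hIb, hsp, hb⟩ := exists_linearIndepOn_extension h (Set.subset_univ _)
  have he : Submodule.span K (v '' b) = Submodule.span K (Set.range v) := by
    apply le_antisymm
    · exact Submodule.span_mono (Set.image_subset_range _ _)
    · rw [Submodule.span_le, ← Set.image_univ]; exact hsp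
  refine ⟨b.toFinset, ?_, by simpa using hb, ?_, by simpa using he⟩
  · intro i hi; simpa using hIb hi
  · rw [← he, Set.image_eq_range, Set.toFinset_card]
    exact (finrank_span_eq_card (b := fun i : b => v i) hb).symm

open Module in
lemma indep_exchange {K V ι : Type*} [Field K] [AddCommGroup V] [Module K V] [Fintype ι]
    [DecidableEq ι]
    (v : ι → V) (B B' : Finset ι) (h : LinearIndepOn K v (B : Set ι))
    (h' : LinearIndepOn K v (B' : Set ι)) (hc : B.card ≤ B'.card) (e : ι) (he : e ∈ B)
    (he' : e ∉ B') :
    ∃ y ∈ B', y ∉ B ∧ LinearIndepOn K v ((insert y (B.erase e) : Finset ι) : Set ι) := by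
  have h1 : LinearIndepOn K v ((B.erase e : Finset ι) : Set ι) :=
    h.mono (by simp)
  have : ∃ y ∈ B', v y ∉ Submodule.span K (v '' (B.erase e : Finset ι)) := by
    by_contra! hcon
    have : FiniteDimensional K (Submodule.span K (v '' (B.erase e : Finset ι))) :=
      FiniteDimensional.span_of_finite K ((B.erase e).finite_toSet.image v)
    have h2 := indep_card_le v B' h' _ hcon
    have h3 : finrank K (Submodule.span K (v '' (B.erase e : Finset ι))) = (B.erase e).card := by
      rw [Set.image_eq_range]
      exact (finrank_span_eq_card (b := fun i : ((B.erase e : Finset ι) : Set ι) => v i) h1).trans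
        (Fintype.card_coe (B.erase e))
    have := Finset.card_erase_lt_of_mem he
    omega
  obtain ⟨y, hy, hyn⟩ := this
  have hyB : y ∉ B.erase e := fun hh => hyn (Submodule.subset_span ⟨y, hh, rfl⟩)
  refine ⟨y, hy, fun hh => hyB (Finset.mem_erase.2 ⟨fun h => he' (h ▸ hy), hh⟩), ?_⟩
  rw [Finset.coe_insert]
  exact h1.insert hyn

open Module in
lemma max_base {K V ι : Type*} [Field K] [AddCommGroup V] [Module K V] [Fintype ι]
    (v : ι → V) (w : ι → ℕ) (hw : Function.Injective w) :
    ∃ I : Finset ι, LinearIndepOn K v (I : Set ι) ∧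
      I.card = finrank K (Submodule.span K (Set.range v)) ∧
      (∀ I' : Finset ι, LinearIndepOn K v (I' : Set ι) → ∑ i ∈ I', w i ≤ ∑ i ∈ I, w i) ∧
      (∀ I' : Finset ι, LinearIndepOn K v (I' : Set ι) →
        I'.card = finrank K (Submodule.span K (Set.range v)) →
        ∑ i ∈ I', w i = ∑ i ∈ I, w i → I' = I) := by
  classical
  let S : Finset (Finset ι) := Finset.univ.filter fun I => LinearIndepOn K v (I : Set ι) ∧
      I.card = finrank K (Submodule.span K (Set.range v))
  have hS : S.Nonempty := by
    obtain ⟨B, -, h1, h2, -⟩ := indep_extend (K := K) v ∅ (by simp)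
    exact ⟨B, by simp [S, h1, h2]⟩
  obtain ⟨I, hI, hmax⟩ := S.exists_max_image (fun I => ∑ i ∈ I, w i) hS
  simp only [S, Finset.mem_filter, Finset.mem_univ, true_and] at hI hmax
  have key : ∀ A B : Finset ι, LinearIndepOn K v (A : Set ι) → LinearIndepOn K v (B : Set ι) →
      A.card = finrank K (Submodule.span K (Set.range v)) →
      B.card = finrank K (Submodule.span K (Set.range v)) →
      ∑ i ∈ A, w i = ∑ i ∈ I, w i → ∀ e ∈ A, e ∉ B → (∀ y ∈ B, y ∉ A → w e ≤ w y) → False := by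
    intro A B hA hB hAc hBc hAw e he heB hmin
    obtain ⟨y, hy, hyA, hind⟩ := indep_exchange v A B hA hB (by omega) e he heB
    have hyA' : y ∉ A.erase e := fun h => hyA (Finset.mem_of_mem_erase h)
    have h1 := hmax _ ⟨hind, by
      rw [Finset.card_insert_of_notMem hyA', Finset.card_erase_of_mem he]
      have := Finset.card_pos.2 ⟨e, he⟩
      omega⟩
    rw [Finset.sum_insert hyA', ← hAw, ← Finset.add_sum_erase _ _ he] at h1
    have h2 := hmin y hy hyA
    have h3 : w e ≠ w y := fun h => hyA (hw h ▸ he)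
    omega
  refine ⟨I, hI.1, hI.2, ?_, ?_⟩
  · intro I' hI'
    obtain ⟨B, hB, h1, h2, -⟩ := indep_extend v I' hI'
    exact (Finset.sum_le_sum_of_subset hB).trans (hmax B ⟨h1, h2⟩)
  · intro I' hI' hc hsum
    by_contra hne
    have hD : (symmDiff I' I).Nonempty := by
      rw [Finset.nonempty_iff_ne_empty]; intro h
      exact hne (symmDiff_eq_bot.1 h)
    obtain ⟨e, he, hmin⟩ := (symmDiff I' I).exists_min_image w hD
    rw [Finset.mem_symmDiff] at he
    rcases he with ⟨h1, h2⟩ | ⟨h1, h2⟩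
    · exact key I' I hI' hI.1 hc hI.2 hsum e h1 h2
        fun y hy hy' => hmin y (Finset.mem_symmDiff.2 (Or.inr ⟨hy, hy'⟩))
    · exact key I I' hI.1 hI' hI.2 hc rfl e h1 h2
        fun y hy hy' => hmin y (Finset.mem_symmDiff.2 (Or.inl ⟨hy, hy'⟩))

lemma sum_range_le_sum_inj {ι : Type*} (S : Finset ι) (w : ι → ℕ)
    (hw : Set.InjOn w (S : Set ι)) :
    ∑ i ∈ Finset.range S.card, i ≤ ∑ i ∈ S, w i := by
  classical
  induction S using Finset.strongInduction with
  | H S ih =>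
    rcases S.eq_empty_or_nonempty with rfl | hne
    · simp
    obtain ⟨e, he, hmax⟩ := S.exists_max_image w hne
    have h1 := ih (S.erase e) (Finset.erase_ssubset he) (hw.mono (by simp))
    rw [← Finset.add_sum_erase _ _ he]
    have hc : S.card = (S.erase e).card + 1 := (Finset.card_erase_add_one he).symm
    rw [hc, Finset.sum_range_succ]
    have : S.card ≤ w e + 1 := by
      rw [← Finset.card_image_of_injOn hw, ← Finset.card_range (w e + 1)]
      apply Finset.card_le_card
      intro x hx
      obtain ⟨i, hi, rfl⟩ := Finset.mem_image.1 hx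
      simpa using Nat.lt_succ_of_le (hmax i hi)
    omega

/-- The weight of a minor with row set `I` and column set `J`. -/
def xwt {m n : ℕ} (I : Finset (Fin m)) (J : Finset (Fin n)) : ℕ :=
  ∑ i ∈ I, (m - (i : ℕ)) + ∑ j ∈ J, (n - 1 - (j : ℕ))

lemma row_wt {m : ℕ} (I : Finset (Fin m)) :
    ∑ i ∈ I, (m - (i : ℕ)) = ∑ i ∈ I, (m - 1 - (i : ℕ)) + I.card := by
  rw [Finset.card_eq_sum_ones, ← Finset.sum_add_distrib]
  apply Finset.sum_congr rfl
  intro i _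
  have := i.2
  omega

lemma wt_inj (m : ℕ) : Function.Injective (fun i : Fin m => m - 1 - (i : ℕ)) := by
  intro i j h
  have := i.2
  have := j.2
  simp only at h
  ext
  omega

lemma wt_inj' (m : ℕ) : Function.Injective (fun i : Fin m => m - (i : ℕ)) := by
  intro i j h
  have := i.2
  have := j.2
  simp only at h
  ext
  omega

lemma range_sum_sq (u : ℕ) : 2 * ∑ i ∈ Finset.range u, i + u = u ^ 2 := by
  induction u with
  | zero => simp
  | succ u ih => rw [Finset.sum_range_succ]; nlinarith

lemma xwt_ge {m n : ℕ} (I : Finset (Fin m)) (J : Finset (Fin n)) (h : I.card = J.card) :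
    I.card ^ 2 ≤ xwt I J := by
  have h1 := sum_range_le_sum_inj I _ (wt_inj m).injOn
  have h2 := sum_range_le_sum_inj J _ (wt_inj n).injOn
  have h3 := range_sum_sq I.card
  rw [← h] at h2
  rw [xwt, row_wt]
  omega

lemma xwt_ge_mem {m n : ℕ} (I : Finset (Fin m)) (J : Finset (Fin n)) (h : I.card = J.card)
    (r : Fin m) (s : Fin n) (hr : r ∈ I) (hs : s ∈ J) :
    m + n + (I.card - 1) ^ 2 ≤ xwt I J + r + s + 1 := by
  have h1 := xwt_ge (I.erase r) (J.erase s)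
    (by rw [Finset.card_erase_of_mem hr, Finset.card_erase_of_mem hs, h])
  rw [Finset.card_erase_of_mem hr] at h1
  unfold xwt at *
  rw [← Finset.add_sum_erase _ _ hr, ← Finset.add_sum_erase _ _ hs]
  have := r.2
  have := s.2
  omega

lemma xwt_le {m n : ℕ} (I : Finset (Fin m)) (J : Finset (Fin n)) (h : I.card = J.card) :
    xwt I J ≤ m * n := by
  have h1 := sum_range_le_sum_inj I _ (Fin.val_injective (n := m)).injOn
  have h2 := sum_range_le_sum_inj J _ (Fin.val_injective (n := n)).injOn
  have h3 := range_sum_sq I.card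
  rw [← h] at h2
  have h4 : ∑ i ∈ I, (m - (i : ℕ)) + ∑ i ∈ I, (i : ℕ) = I.card * m := by
    rw [← Finset.sum_add_distrib, ← smul_eq_mul, ← Finset.sum_const]
    exact Finset.sum_congr rfl fun i _ => by have := i.2; omega
  have h5 : ∑ i ∈ J, (n - 1 - (i : ℕ)) + ∑ i ∈ J, (i : ℕ) + J.card = J.card * n := by
    rw [← Finset.sum_add_distrib, Finset.card_eq_sum_ones, ← Finset.sum_add_distrib,
      Finset.sum_mul]
    exact Finset.sum_congr rfl fun i _ => by have := i.2; omega
  rw [← h] at h5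
  have h6 : I.card ≤ m := by simpa using I.card_le_univ
  have h7 : I.card ≤ n := by rw [h]; simpa using J.card_le_univ
  unfold xwt
  obtain ⟨a, ha⟩ := Nat.exists_eq_add_of_le h6
  obtain ⟨b, hb⟩ := Nat.exists_eq_add_of_le h7
  have h8 : m * n + I.card ^ 2 = I.card * m + I.card * n + a * b := by
    generalize I.card = u at ha hb
    rw [ha, hb]
    ring
  omega

/-- The minor of `A` with row set `I` and column set `J`. -/
def xminor {R : Type*} [CommRing R] {m n : ℕ} (A : Matrix (Fin m) (Fin n) R)
    (I : Finset (Fin m)) (J : Finset (Fin n)) : R :=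
  if h : J.card = I.card then
    (A.submatrix (I.orderEmbOfFin rfl) (J.orderEmbOfFin h)).det else 0

lemma xminor_map {R S : Type*} [CommRing R] [CommRing S] {m n : ℕ} (φ : R →+* S)
    (A : Matrix (Fin m) (Fin n) R) (I : Finset (Fin m)) (J : Finset (Fin n)) :
    φ (xminor A I J) = xminor (A.map φ) I J := by
  unfold xminor
  split_ifs with h
  · rw [RingHom.map_det]; rfl
  · simp

lemma xminor_congr {R : Type*} [CommRing R] {m n : ℕ}
    (A B : Matrix (Fin m) (Fin n) R) (I : Finset (Fin m)) (J : Finset (Fin n))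
    (h : ∀ i ∈ I, ∀ j ∈ J, A i j = B i j) : xminor A I J = xminor B I J := by
  unfold xminor
  split_ifs with hc
  · congr 1
    ext a b
    exact h _ (Finset.orderEmbOfFin_mem _ _ _) _ (Finset.orderEmbOfFin_mem _ _ _)
  · rfl

/-- The sum of all minors of size at least `t` and weight `s`. -/
def xsum {R : Type*} [CommRing R] {m n : ℕ} (t : ℕ) (A : Matrix (Fin m) (Fin n) R)
    (s : ℕ) : R :=
  ∑ p : Finset (Fin m) × Finset (Fin n),
    if t ≤ p.1.card ∧ p.1.card = p.2.card ∧ xwt p.1 p.2 = s then xminor A p.1 p.2 else 0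

lemma xsum_map {R S : Type*} [CommRing R] [CommRing S] {m n : ℕ} (φ : R →+* S) (t : ℕ)
    (A : Matrix (Fin m) (Fin n) R) (s : ℕ) :
    φ (xsum t A s) = xsum t (A.map φ) s := by
  unfold xsum
  rw [map_sum]
  refine Finset.sum_congr rfl fun p _ => ?_
  split_ifs
  · exact xminor_map _ _ _ _
  · simp

lemma xsum_congr {R : Type*} [CommRing R] {m n : ℕ} (t h : ℕ) (ht1 : 1 ≤ t)
    (A B : Matrix (Fin m) (Fin n) R) (hh : h ≤ 2 * t)
    (hAB : ∀ (i : Fin m) (j : Fin n), m + n ≤ (i : ℕ) + j + h + 2 * t → A i j = B i j) :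
    xsum t A (t ^ 2 + h) = xsum t B (t ^ 2 + h) := by
  unfold xsum
  refine Finset.sum_congr rfl fun p _ => ?_
  split_ifs with hp
  · obtain ⟨h1, h2, h3⟩ := hp
    have h4 : p.1.card = t := by
      have := xwt_ge p.1 p.2 h2
      by_contra hne
      have : t + 1 ≤ p.1.card := by omega
      nlinarith
    refine xminor_congr _ _ _ _ fun i hi j hj => hAB i j ?_
    have h5 := xwt_ge_mem p.1 p.2 h2 i j hi hj
    rw [h3, h4] at h5
    obtain ⟨q, rfl⟩ := Nat.exists_eq_add_of_le' ht1
    simp only [Nat.add_sub_cancel] at h5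
    nlinarith
  · rfl

lemma det_ne_of_span {K : Type*} [Field K] {m n u : ℕ} (A : Matrix (Fin m) (Fin n) K)
    (r : Fin u → Fin m) (c : Fin u → Fin n)
    (hr : LinearIndependent K (fun k => A (r k)))
    (hc : ∀ j, A.col j ∈ Submodule.span K (Set.range fun l => A.col (c l))) :
    (A.submatrix r c).det ≠ 0 := by
  intro hdet
  obtain ⟨y, hy0, hy⟩ := Matrix.exists_vecMul_eq_zero_iff.2 hdet
  let φ : (Fin m → K) →ₗ[K] K := ∑ k, y k • LinearMap.proj (r k)
  have hφ : ∀ z, φ z = ∑ k, y k * z (r k) := fun z => by simp [φ]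
  have hker : Submodule.span K (Set.range fun l => A.col (c l)) ≤ LinearMap.ker φ := by
    rw [Submodule.span_le]
    rintro _ ⟨l, rfl⟩
    have := congrFun hy l
    simpa [hφ, Matrix.vecMul, dotProduct] using this
  apply hy0
  have := Fintype.linearIndependent_iff.1 hr y (by
    ext j
    have := hker (hc j)
    rw [LinearMap.mem_ker, hφ] at this
    simpa using this)
  exact funext this

lemma rows_indep {K : Type*} [Field K] {m n u : ℕ} (A : Matrix (Fin m) (Fin n) K)
    (r : Fin u → Fin m) (c : Fin u → Fin n) (h : (A.submatrix r c).det ≠ 0) :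
    LinearIndependent K (fun k => A (r k)) := by
  have h1 := Matrix.linearIndependent_rows_of_det_ne_zero h
  exact LinearIndependent.of_comp (LinearMap.funLeft K K c) h1

lemma cols_indep {K : Type*} [Field K] {m n u : ℕ} (A : Matrix (Fin m) (Fin n) K)
    (r : Fin u → Fin m) (c : Fin u → Fin n) (h : (A.submatrix r c).det ≠ 0) :
    LinearIndependent K (fun k => A.col (c k)) := by
  have h1 := Matrix.linearIndependent_cols_of_det_ne_zero h
  exact LinearIndependent.of_comp (LinearMap.funLeft K K r) h1

lemma indepOn_iff {K V : Type*} [Field K] [AddCommGroup V] [Module K V] {m u : ℕ}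
    (v : Fin m → V) (I : Finset (Fin m)) (h : I.card = u) :
    LinearIndepOn K v (I : Set (Fin m)) ↔ LinearIndependent K (fun k => v (I.orderEmbOfFin h k)) := by
  have := linearIndepOn_range_iff (R := K) (I.orderEmbOfFin h).injective v
  rw [Finset.range_orderEmbOfFin] at this
  exact this

lemma xminor_ne {K : Type*} [Field K] {m n : ℕ} (A : Matrix (Fin m) (Fin n) K)
    (I : Finset (Fin m)) (J : Finset (Fin n)) (h : xminor A I J ≠ 0) :
    I.card = J.card ∧ LinearIndepOn K A.row (I : Set (Fin m)) ∧
      LinearIndepOn K A.col (J : Set (Fin n)) := by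
  unfold xminor at h
  split_ifs at h with hc
  · exact ⟨hc.symm, (indepOn_iff _ _ rfl).2 (rows_indep A _ _ h),
      (indepOn_iff _ _ hc).2 (cols_indep A _ _ h)⟩
  · exact absurd rfl h

lemma xminor_ne_of {K : Type*} [Field K] {m n : ℕ} (A : Matrix (Fin m) (Fin n) K)
    (I : Finset (Fin m)) (J : Finset (Fin n)) 
    (hI : LinearIndepOn K A.row (I : Set (Fin m)))
    (hJ : LinearIndepOn K A.col (J : Set (Fin n)))
    (hIc : I.card = A.rank) (hJc : J.card = A.rank) : xminor A I J ≠ 0 := by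
  have hc : J.card = I.card := by omega
  unfold xminor
  rw [dif_pos hc]
  apply det_ne_of_span
  · exact (indepOn_iff _ _ rfl).1 hI
  · intro j
    obtain ⟨B, hJB, h1, h2, h3⟩ := indep_extend A.col J hJ
    rw [← Matrix.rank_eq_finrank_span_cols] at h2
    have : J = B := Finset.eq_of_subset_of_card_le hJB (by omega)
    subst this
    have h4 : (Set.range fun l => A.col (J.orderEmbOfFin hc l)) = A.col '' J := by
      rw [← Finset.range_orderEmbOfFin J hc, ← Set.range_comp]; rfl
    rw [h4, h3]
    exact Submodule.subset_span ⟨j, rfl⟩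

lemma exists_minor {K : Type*} [Field K] {m n : ℕ} (t : ℕ) (A : Matrix (Fin m) (Fin n) K)
    (I : Finset (Fin m)) (hI : LinearIndepOn K A.row (I : Set (Fin m))) (hc : t ≤ I.card) :
    ∃ (r : Fin t → Fin m) (c : Fin t → Fin n), Function.Injective r ∧ Function.Injective c ∧
      (A.submatrix r c).det ≠ 0 := by
  obtain ⟨I0, hI0, hI0c⟩ := Finset.exists_subset_card_eq hc
  have h0 : LinearIndepOn K A.row (I0 : Set (Fin m)) := hI.mono (by exact_mod_cast hI0)
  rw [indepOn_iff _ _ hI0c] at h0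
  let r := I0.orderEmbOfFin hI0c
  let A' : Matrix (Fin t) (Fin n) K := A.submatrix r id
  have hr : A'.rank = t := by
    have := LinearIndependent.rank_matrix (M := A') h0
    simpa using this
  obtain ⟨J, -, h1, h2, h3⟩ := indep_extend (K := K) A'.col ∅ (by simp)
  rw [← Matrix.rank_eq_finrank_span_cols, hr] at h2
  refine ⟨r, J.orderEmbOfFin h2, r.injective, (J.orderEmbOfFin h2).injective, ?_⟩
  have := det_ne_of_span A' id (J.orderEmbOfFin h2) h0 (by
    intro j
    have h4 : (Set.range fun l => A'.col (J.orderEmbOfFin h2 l)) = A'.col '' J := by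
      rw [← Finset.range_orderEmbOfFin J h2, ← Set.range_comp]; rfl
    rw [h4, h3]
    exact Submodule.subset_span ⟨j, rfl⟩)
  exact this

lemma xsum_eq_zero {K : Type*} [Field K] {m n : ℕ} (t : ℕ) (A : Matrix (Fin m) (Fin n) K)
    (h : ∀ (r : Fin t → Fin m) (c : Fin t → Fin n), Function.Injective r →
      Function.Injective c → (A.submatrix r c).det = 0) (s : ℕ) : xsum t A s = 0 := by
  unfold xsum
  refine Finset.sum_eq_zero fun p _ => ?_
  split_ifs with hp
  · by_contra hne
    obtain ⟨-, h1, -⟩ := xminor_ne A _ _ hne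
    obtain ⟨r, c, hr, hc, hd⟩ := exists_minor t A _ h1 hp.1
    exact hd (h r c hr hc)
  · rfl

lemma max_minor {K : Type*} [Field K] {m n : ℕ} (t : ℕ) (A : Matrix (Fin m) (Fin n) K)
    (r : Fin t → Fin m) (c : Fin t → Fin n) (hd : (A.submatrix r c).det ≠ 0) :
    ∃ (I : Finset (Fin m)) (J : Finset (Fin n)), I.card = J.card ∧ t ≤ I.card ∧
      xsum t A (xwt I J) ≠ 0 ∧
      ∀ i j, A i j ≠ 0 → ∃ (I' : Finset (Fin m)) (J' : Finset (Fin n)), i ∈ I' ∧ j ∈ J' ∧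
        I'.card = J'.card ∧ I'.card = I.card ∧ xwt I' J' ≤ xwt I J := by
  have hrank : t ≤ A.rank := by
    have h1 := Matrix.rank_of_det_ne_zero hd
    have h2 := Matrix.rank_submatrix_le A r c
    simp at h1
    omega
  obtain ⟨I, hI, hIc, hImax, hIu⟩ := max_base (K := K) A.row (fun i => m - (i : ℕ)) (wt_inj' m)
  obtain ⟨J, hJ, hJc, hJmax, hJu⟩ := max_base (K := K) A.col (fun i => n - 1 - (i : ℕ)) (wt_inj n)
  rw [← Matrix.rank_eq_finrank_span_row] at hIc hIu
  rw [← Matrix.rank_eq_finrank_span_cols] at hJc hJu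
  refine ⟨I, J, by omega, by omega, ?_, ?_⟩
  · unfold xsum
    rw [Finset.sum_eq_single (I, J)]
    · rw [if_pos ⟨by simp only; omega, by simp only; omega, rfl⟩]
      exact xminor_ne_of A I J hI hJ hIc hJc
    · rintro ⟨I', J'⟩ - hne
      split_ifs with hp
      · by_contra hmin
        obtain ⟨h1, h2, h3⟩ := xminor_ne A _ _ hmin
        obtain ⟨-, -, hw⟩ := hp
        have a1 := hImax I' h2
        have a2 := hJmax J' h3
        unfold xwt at hw
        dsimp only at hw h1 h2 h3
        have b1 : ∑ i ∈ I', (m - (i : ℕ)) = ∑ i ∈ I, (m - (i : ℕ)) := by omega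
        have b2 : ∑ i ∈ J', (n - 1 - (i : ℕ)) = ∑ i ∈ J, (n - 1 - (i : ℕ)) := by omega
        have c1 : I'.card = A.rank := by
          obtain ⟨B, hB, d1, d2, -⟩ := indep_extend A.row I' h2
          rw [← Matrix.rank_eq_finrank_span_row] at d2
          have d3 := hImax B d1
          rw [← b1, ← Finset.sum_sdiff hB] at d3
          have d4 : B \ I' = ∅ := by
            by_contra hn
            obtain ⟨e, he⟩ := Finset.nonempty_iff_ne_empty.2 hn
            have d5 := Finset.single_le_sum (f := fun i : Fin m => m - (i : ℕ))
              (fun _ _ => Nat.zero_le _) he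
            have := e.2
            omega
          rw [Finset.sdiff_eq_empty_iff_subset] at d4
          rw [Finset.Subset.antisymm hB d4, d2]
        exact hne (Prod.ext (hIu I' h2 c1 b1) (hJu J' h3 (by omega) b2))
      · rfl
    · intro h; exact absurd (Finset.mem_univ _) h
  · intro i j hij
    have hi : LinearIndepOn K A.row (({i} : Finset (Fin m)) : Set (Fin m)) := by
      rw [Finset.coe_singleton]
      exact LinearIndepOn.singleton (fun h => hij (congrFun h j))
    have hj : LinearIndepOn K A.col (({j} : Finset (Fin n)) : Set (Fin n)) := by
      rw [Finset.coe_singleton]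
      exact LinearIndepOn.singleton (fun h => hij (congrFun h i))
    obtain ⟨I', hI', d1, d2, -⟩ := indep_extend A.row _ hi
    obtain ⟨J', hJ', e1, e2, -⟩ := indep_extend A.col _ hj
    rw [← Matrix.rank_eq_finrank_span_row] at d2
    rw [← Matrix.rank_eq_finrank_span_cols] at e2
    exact ⟨I', J', hI' (by simp), hJ' (by simp), by omega, by omega,
      Nat.add_le_add (hImax I' d1) (hJmax J' e1)⟩

lemma pointwise {K : Type*} [Field K] {m n : ℕ} (t k : ℕ) (A : Matrix (Fin m) (Fin n) K)
    (hmn : m ≤ n) (ht1 : 1 ≤ t) (htm : t ≤ m)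
    (hk2 : k ≤ 2 * t + 1) (hk3 : k ≤ m + n - 2 * t)
    (P : ℕ → Fin m × Fin n) (hP : ∀ h < k, ((P h).1 : ℕ) + (P h).2 ≤ h)
    (hA : ∀ h < k, A (P (k - 1 - h)).1 (P (k - 1 - h)).2 = xsum t A (t ^ 2 + h))
    (hz : ∀ h, k ≤ h → t ^ 2 + h ≤ m * n → xsum t A (t ^ 2 + h) = 0)
    (r : Fin t → Fin m) (c : Fin t → Fin n) : (A.submatrix r c).det = 0 := by
  by_contra hd
  obtain ⟨I, J, hc, htI, hs, hent⟩ := max_minor t A r c hd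
  have h1 := xwt_ge I J hc
  have h2 := xwt_le I J hc
  have h3 : t ^ 2 ≤ I.card ^ 2 := Nat.pow_le_pow_left htI 2
  obtain ⟨h, hh⟩ := Nat.exists_eq_add_of_le (h3.trans h1)
  rw [hh] at hs
  have hhk : h < k := by
    by_contra hge
    exact hs (hz h (by omega) (by omega))
  have hcard : I.card = t := by
    by_contra hne
    have : t + 1 ≤ I.card := by omega
    nlinarith
  rw [← hA h hhk] at hs
  obtain ⟨I', J', hi, hj, hc', hcI, hle⟩ := hent _ _ hs
  have h5 := xwt_ge_mem I' J' hc' _ _ hi hj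
  have h6 := hP (k - 1 - h) (by omega)
  rw [hcI, hcard] at h5
  obtain ⟨q, rfl⟩ := Nat.exists_eq_add_of_le' ht1
  simp only [Nat.add_sub_cancel] at h5
  have h7 : (q + 1) ^ 2 = q ^ 2 + 2 * q + 1 := by ring
  omega

lemma exists_fill {K R : Type*} [Field K] [CommRing R] {m n : ℕ} (t k : ℕ)
    (X : Matrix (Fin m) (Fin n) (R))
    (hmn : m ≤ n) (ht1 : 1 ≤ t) (htm : t ≤ m)
    (hk2 : k ≤ 2 * t + 1) (hk3 : k ≤ m + n - 2 * t)
    (P : ℕ → Fin m × Fin n) (hP : ∀ h < k, ((P h).1 : ℕ) + (P h).2 ≤ h)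
    (hinj : ∀ a < k, ∀ b < k, P a = P b → a = b) 
    (hX : ∀ h < k, X (P h).1 (P h).2 = 0) (q : ℕ) (hq : q ≤ k) :
    ∃ Z : Matrix (Fin m) (Fin n) (R),
      (∀ h < q, Z (P (k - 1 - h)).1 (P (k - 1 - h)).2 = xsum t Z (t ^ 2 + h)) ∧
      (∀ i j, (∀ h < q, P (k - 1 - h) ≠ (i, j)) → Z i j = X i j) ∧
      (∀ φ : R →+* K, (∀ (r : Fin t → Fin m) (c : Fin t → Fin n), Function.Injective r →
          Function.Injective c →
          ((X.map φ).submatrix r c).det = 0) →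
        Z.map φ = X.map φ) := by
  induction q with
  | zero => exact ⟨X, by simp, by simp, by simp⟩
  | succ q ih =>
    obtain ⟨Z, h1, h2, h3⟩ := ih (by omega)
    let Z' : Matrix (Fin m) (Fin n) (R) :=
      fun i j => if P (k - 1 - q) = (i, j) then xsum t Z (t ^ 2 + q) else Z i j
    have hcongr : ∀ h ≤ q, xsum t Z' (t ^ 2 + h) = xsum t Z (t ^ 2 + h) := by
      intro h hh
      apply xsum_congr t h ht1 _ _ (by omega)
      intro i j hij
      simp only [Z']
      rw [if_neg]
      intro he
      have := hP (k - 1 - q) (by omega)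
      rw [he] at this
      simp only at this
      omega
    refine ⟨Z', ?_, ?_, ?_⟩
    · intro h hh
      rw [hcongr h (by omega)]
      rcases Nat.lt_succ_iff_lt_or_eq.1 hh with hlt | rfl
      · rw [← h1 h hlt]
        simp only [Z']
        rw [if_neg]
        intro he
        have := hinj _ (by omega) _ (by omega) he
        omega
      · simp [Z']
    · intro i j hij
      simp only [Z']
      rw [if_neg (hij q (by omega))]
      exact h2 i j fun h hh => hij h (by omega)
    · intro φ hφ
      have h4 := h3 φ hφ
      rw [← h4]
      ext i j
      change φ (Z' i j) = φ (Z i j)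
      simp only [Z']
      split_ifs with he
      · have h6 : Z i j = X i j := by
          apply h2
          intro h hh hn
          have := hinj _ (by omega) _ (by omega) (hn.trans he.symm)
          omega
        have h7 := hX (k - 1 - q) (by omega)
        rw [he] at h7
        rw [xsum_map, h4, xsum_eq_zero t _ hφ, h6, h7, map_zero]
      · rfl

/-- If exactly `k` entries of `X` are zero, with `1 ≤ k ≤ min {2t+1, m+n-2t}`, and they
lie on consecutive antidiagonals starting from the upper-left corner (i.e. the 0-based
position `(r, s)` of the `h`-th zero satisfies `r + s ≤ h`, which in 1-based indexing is
`r + s ≤ h + 1`), then `ara I_t(X) ≤ mn - t² - k + 1`. -/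
theorem stmt3 {K : Type*} [Field K] [IsAlgClosed K] (N m n t k : ℕ)
    (X : Matrix (Fin m) (Fin n) (MvPolynomial (Fin N) K))
    (hmn : m ≤ n) (ht1 : 1 ≤ t) (htm : t ≤ m)
    (hk1 : 1 ≤ k) (hk2 : k ≤ 2 * t + 1) (hk3 : k ≤ m + n - 2 * t)
    (hzeros : ∃ pos : Fin k → Fin m × Fin n, Function.Injective pos ∧
      (∀ (i : Fin m) (j : Fin n), X i j = 0 ↔ ∃ h, pos h = (i, j)) ∧
      ∀ h : Fin k, ((pos h).1 : ℕ) + ((pos h).2 : ℕ) ≤ (h : ℕ)) :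
    araRank (minorsIdeal t X) ≤ m * n - t ^ 2 - k + 1 := by
  obtain ⟨pos, hpinj, hpz, hple⟩ := hzeros
  let P : ℕ → Fin m × Fin n := fun h => if hh : h < k then pos ⟨h, hh⟩ else pos ⟨0, hk1⟩
  have hPe : ∀ h (hh : h < k), P h = pos ⟨h, hh⟩ := fun h hh => by simp [P, hh]
  have hP : ∀ h < k, ((P h).1 : ℕ) + (P h).2 ≤ h := by
    intro h hh
    rw [hPe h hh]
    exact hple _
  have hinj : ∀ a < k, ∀ b < k, P a = P b → a = b := by
    intro a ha b hb hab
    rw [hPe a ha, hPe b hb] at hab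
    simpa using hpinj hab
  have hX : ∀ h < k, X (P h).1 (P h).2 = 0 := by
    intro h hh
    rw [hpz]
    exact ⟨⟨h, hh⟩, (hPe h hh).symm⟩
  obtain ⟨Z, h1, h2, h3⟩ := exists_fill (K := K) t k X hmn ht1 htm hk2 hk3 P hP hinj hX k le_rfl
  let f : Fin (m * n + 1 - t ^ 2 - k) → MvPolynomial (Fin N) K :=
    fun h => xsum t Z (t ^ 2 + (k + h))
  have hmain : (Ideal.span (Set.range f)).radical = (minorsIdeal t X).radical := by
    rw [← MvPolynomial.vanishingIdeal_zeroLocus_eq_radical (K := K),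
      ← MvPolynomial.vanishingIdeal_zeroLocus_eq_radical (K := K)]
    congr 1
    unfold minorsIdeal
    rw [MvPolynomial.zeroLocus_span, MvPolynomial.zeroLocus_span]
    ext x
    let φ : MvPolynomial (Fin N) K →+* K :=
      (MvPolynomial.aeval x : MvPolynomial (Fin N) K →ₐ[K] K).toRingHom
    have hdet : ∀ (Y : Matrix (Fin m) (Fin n) (MvPolynomial (Fin N) K))
        (r : Fin t → Fin m) (c : Fin t → Fin n),
        φ (Y.submatrix r c).det = ((Y.map φ).submatrix r c).det := by
      intro Y r c
      rw [RingHom.map_det]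
      rfl
    simp only [Set.mem_ofPred_eq]
    constructor
    · intro hx
      have hrk : ∀ (r : Fin t → Fin m) (c : Fin t → Fin n),
          ((Z.map φ).submatrix r c).det = 0 := by
        intro r c
        apply pointwise t k (Z.map φ) hmn ht1 htm hk2 hk3 P hP
        · intro h hh
          rw [← xsum_map, ← h1 h hh]
          rfl
        · intro h hkh hle
          rw [← xsum_map]
          have := hx (f ⟨h - k, by omega⟩) ⟨_, rfl⟩
          simp only [f] at this
          rw [Nat.add_sub_cancel' hkh] at this
          exact this
      have hZX : Z.map φ = X.map φ := by
        ext i j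
        by_cases hij : ∃ h < k, P (k - 1 - h) = (i, j)
        · obtain ⟨h, hh, he⟩ := hij
          have e1 := h1 h hh
          have e2 := hX (k - 1 - h) (by omega)
          rw [he] at e1 e2
          simp only at e1 e2
          rw [Matrix.map_apply, Matrix.map_apply, e1, e2, xsum_map,
            xsum_eq_zero t _ (fun r c _ _ => hrk r c), map_zero]
        · push Not at hij
          rw [Matrix.map_apply, Matrix.map_apply, h2 i j hij]
      rintro p ⟨r, c, -, -, rfl⟩
      change φ _ = 0
      rw [hdet, ← hZX]
      exact hrk r c
    · intro hx
      have hφ : ∀ (r : Fin t → Fin m) (c : Fin t → Fin n), Function.Injective r →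
          Function.Injective c → ((X.map φ).submatrix r c).det = 0 := by
        intro r c hr hc
        rw [← hdet]
        exact hx _ ⟨r, c, hr, hc, rfl⟩
      rintro p ⟨h, rfl⟩
      change φ (xsum t Z _) = 0
      rw [xsum_map, h3 φ hφ, xsum_eq_zero t _ hφ]
  calc araRank (minorsIdeal t X) ≤ m * n + 1 - t ^ 2 - k := Nat.sInf_le ⟨f, hmain⟩
    _ ≤ _ := by omega
end

section
/- Let K be an algebraically closed field, R = K[x_1,…,x_N] a polynomial ring over K, and X an (m×n)-matrix with entries in R, where m ≤ n. Let k be an integer with 0 ≤ k ≤ n−m and suppose that k entries of X are zero. Then ara I_m(X) ≤ mn − m² − k + 1. -/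
open Classical in
/-- Sum of the maximal minors whose column set has colength `j`. -/
noncomputable def tauSum {R : Type*} [CommRing R] {m n : ℕ} (X : Matrix (Fin m) (Fin n) R)
    (j : ℕ) : R :=
  ∑ c ∈ (Finset.univ : Finset (Fin m → Fin n)).filter
    (fun c : Fin m → Fin n => StrictMono c ∧ (∑ i, (c i : ℕ)) + j = ∑ i : Fin m, (n - m + (i : ℕ))),
    (X.submatrix id c).det

theorem strictMono_le_aux {m : ℕ} (f : Fin m → ℕ) (hf : StrictMono f) (i : Fin m) :
    (i : ℕ) ≤ f i := by
  obtain ⟨i, hi⟩ := i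
  induction i with
  | zero => simp
  | succ p ih =>
    have h1 := ih (by omega)
    have h2 : f ⟨p, by omega⟩ < f ⟨p + 1, hi⟩ := hf (by simp)
    simp only at h1 ⊢
    omega

theorem strictMono_ub_aux {m n : ℕ} (c : Fin m → Fin n) (hc : StrictMono c) (i : Fin m) :
    (c i : ℕ) ≤ n - m + i := by
  have h := strictMono_le_aux (fun i : Fin m => n - 1 - (c i.rev : ℕ)) (by
    intro a b hab
    have : c b.rev < c a.rev := hc (by simpa using hab)
    have h2 : (c b.rev : ℕ) < c a.rev := this
    have := (c a.rev).2
    simp only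
    omega) i.rev
  simp only [Fin.rev_rev, Fin.val_rev] at h
  have := (c i).2
  have := i.2
  omega

theorem colength_aux {m n j : ℕ} (c : Fin m → Fin n) (hc : StrictMono c)
    (h : (∑ i, (c i : ℕ)) + j = ∑ i : Fin m, (n - m + (i : ℕ))) (r : Fin m) :
    n - m ≤ (c r : ℕ) + j := by
  have h1 : ∑ i ∈ Finset.univ.erase r, (c i : ℕ) ≤ ∑ i ∈ Finset.univ.erase r, (n - m + (i : ℕ)) :=
    Finset.sum_le_sum fun i _ => strictMono_ub_aux c hc i
  rw [← Finset.add_sum_erase _ _ (Finset.mem_univ r),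
    ← Finset.add_sum_erase Finset.univ (fun i : Fin m => n - m + (i : ℕ)) (Finset.mem_univ r)] at h
  omega

theorem tauSum_congr {R : Type*} [CommRing R] {m n : ℕ} (X Y : Matrix (Fin m) (Fin n) R)
    (j : ℕ) (h : ∀ r (v : Fin n), n - m ≤ (v : ℕ) + j → X r v = Y r v) :
    tauSum X j = tauSum Y j := by
  unfold tauSum
  refine Finset.sum_congr rfl fun c hc => ?_
  simp only [Finset.mem_filter, Finset.mem_univ, true_and] at hc
  congr 1
  ext r i
  exact h _ _ (colength_aux c hc.1 hc.2 i)

theorem map_tauSum {R S : Type*} [CommRing R] [CommRing S] (φ : R →+* S) {m n : ℕ}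
    (X : Matrix (Fin m) (Fin n) R) (j : ℕ) :
    φ (tauSum X j) = tauSum (X.map φ) j := by
  unfold tauSum
  rw [map_sum]
  refine Finset.sum_congr rfl fun c _ => ?_
  rw [RingHom.map_det]
  rfl

theorem sort_aux {F : Type*} [Field F] {m n : ℕ} (M : Matrix (Fin m) (Fin n) F)
    (c : Fin m → Fin n) (hc : Function.Injective c) (hd : (M.submatrix id c).det ≠ 0) :
    ∃ c' : Fin m → Fin n, StrictMono c' ∧ (M.submatrix id c').det ≠ 0 ∧
      ∑ i, (c' i : ℕ) = ∑ i, (c i : ℕ) := by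
  refine ⟨c ∘ Tuple.sort c, (Tuple.monotone_sort c).strictMono_of_injective
    (hc.comp (Equiv.injective _)), ?_, Equiv.sum_comp (Tuple.sort c) (fun i => (c i : ℕ))⟩
  have := Matrix.det_permute' (Tuple.sort c) (M.submatrix id c)
  rw [Matrix.submatrix_submatrix] at this
  have h2 : (id ∘ id : Fin m → Fin m) = id := rfl
  rw [h2] at this
  rw [this]
  refine mul_ne_zero ?_ hd
  rcases Int.units_eq_one_or (Equiv.Perm.sign (Tuple.sort c)) with h | h <;> simp [h]

theorem gale_aux {F : Type*} [Field F] {m n : ℕ} (hmn : m ≤ n) (M : Matrix (Fin m) (Fin n) F)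
    (c₀ : Fin m → Fin n) (hc₀ : Function.Injective c₀) (hd₀ : (M.submatrix id c₀).det ≠ 0) :
    ∃ j, j ≤ m * (n - m) ∧ tauSum M j ≠ 0 ∧
      ∀ r (v : Fin n), (v : ℕ) + j < n - m → M r v = 0 := by
  classical
  -- minimal weight choice
  let P : ℕ → Prop := fun w => ∃ c : Fin m → Fin n, StrictMono c ∧
    (M.submatrix id c).det ≠ 0 ∧ ∑ i, (c i : ℕ) = w
  have hP : ∃ w, P w := by
    obtain ⟨c, h1, h2, h3⟩ := sort_aux M c₀ hc₀ hd₀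
    exact ⟨_, c, h1, h2, rfl⟩
  obtain ⟨c, hcm, hcd, hcw⟩ := Nat.find_spec hP
  have hmin : ∀ c' : Fin m → Fin n, Function.Injective c' → (M.submatrix id c').det ≠ 0 →
      ∑ i, (c i : ℕ) ≤ ∑ i, (c' i : ℕ) := by
    intro c' h1 h2
    obtain ⟨c'', h3, h4, h5⟩ := sort_aux M c' h1 h2
    rw [hcw, ← h5]
    exact Nat.find_min' hP ⟨c'', h3, h4, rfl⟩
  set A := M.submatrix id c with hA
  have hAu : IsUnit A.det := isUnit_iff_ne_zero.mpr hcd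
  set B := A⁻¹ * M with hB
  have hAB : A * B = M := by rw [hB, ← Matrix.mul_assoc, Matrix.mul_nonsing_inv _ hAu, Matrix.one_mul]
  have hBz : ∀ r (v : Fin n), v < c r → B r v = 0 := by
    intro r v hv
    by_contra hne
    -- replaced determinant
    have hdet : (M.submatrix id (Function.update c r v)).det = A.det * B r v := by
      have e1 : M.submatrix id (Function.update c r v) = A.updateCol r (fun i => M i v) := by
        ext i s
        by_cases hs : s = r
        · subst hs; simp
        · simp [hs, hA]
      have e2 : (fun i => M i v) = A.mulVec (fun i => B i v) := by
        ext i
        conv_lhs => rw [← hAB]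
        rfl
      rw [e1, ← Matrix.cramer_apply, e2, Matrix.cramer_eq_adjugate_mulVec, Matrix.mulVec_mulVec,
        Matrix.adjugate_mul]
      simp [Matrix.smul_mulVec]
    have hdne : (M.submatrix id (Function.update c r v)).det ≠ 0 := by
      rw [hdet]; exact mul_ne_zero hcd hne
    have hinj : Function.Injective (Function.update c r v) := by
      intro a b hab
      by_contra hne'
      exact hdne (Matrix.det_zero_of_column_eq hne' (fun i => by simp [hab]))
    have h1 := hmin _ hinj hdne
    have h2 : ∑ i, ((Function.update c r v) i : ℕ) < ∑ i, (c i : ℕ) := by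
      refine Finset.sum_lt_sum (fun i _ => ?_) ⟨r, Finset.mem_univ _, by simpa using hv⟩
      by_cases hi : i = r
      · subst hi; simpa using hv.le
      · simp [hi]
    omega
  have huniq : ∀ c' : Fin m → Fin n, StrictMono c' → (M.submatrix id c').det ≠ 0 →
      ∑ i, (c' i : ℕ) = ∑ i, (c i : ℕ) → c' = c := by
    intro c' hc' hd' hw
    have hBd : (B.submatrix id c').det ≠ 0 := by
      intro h0
      apply hd'
      have : M.submatrix id c' = A * B.submatrix id c' := by
        conv_lhs => rw [← hAB]
        rfl
      rw [this, Matrix.det_mul, h0, mul_zero]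
    rw [← Matrix.det_transpose, Matrix.det_apply] at hBd
    obtain ⟨π, -, hπ⟩ := Finset.exists_ne_zero_of_sum_ne_zero hBd
    have hprod : ∏ i, (B.submatrix id c').transpose (π i) i ≠ 0 := by
      intro h0; rw [h0, smul_zero] at hπ; exact hπ rfl
    have hle : ∀ i, c i ≤ c' (π i) := by
      intro i
      have := Finset.prod_ne_zero_iff.mp hprod i (Finset.mem_univ _)
      by_contra hlt
      exact this (hBz _ _ (not_le.mp hlt))
    have hsum : ∑ i, (c i : ℕ) = ∑ i, (c' (π i) : ℕ) := by
      rw [Equiv.sum_comp π (fun i => (c' i : ℕ)), hw]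
    have heq := (Finset.sum_eq_sum_iff_of_le (f := fun i => (c i : ℕ))
      (g := fun i => (c' (π i) : ℕ)) (fun i _ => (hle i : (c i : ℕ) ≤ c' (π i)))).mp hsum
    have hcc : c = c' ∘ π := by
      ext i; exact heq i (Finset.mem_univ _)
    have hr : Set.range c' = Set.range c := by
      rw [hcc, Set.range_comp, π.surjective.range_eq, Set.image_univ]
    exact (StrictMono.range_inj hc' hcm).mp hr
  have hle : ∑ i, (c i : ℕ) ≤ ∑ i : Fin m, (n - m + (i : ℕ)) :=
    Finset.sum_le_sum fun i _ => strictMono_ub_aux c hcm i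
  have hge : ∑ i : Fin m, (i : ℕ) ≤ ∑ i, (c i : ℕ) :=
    Finset.sum_le_sum fun i _ => strictMono_le_aux (fun i => (c i : ℕ)) (fun a b h => hcm h) i
  have hT : ∑ i : Fin m, (n - m + (i : ℕ)) = m * (n - m) + ∑ i : Fin m, (i : ℕ) := by
    rw [Finset.sum_add_distrib]; simp
  obtain ⟨j, hj⟩ := Nat.exists_eq_add_of_le hle
  refine ⟨j, by omega, ?_, ?_⟩
  · unfold tauSum
    rw [Finset.sum_eq_single_of_mem c]
    · exact hcd
    · simp only [Finset.mem_filter, Finset.mem_univ, true_and]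
      exact ⟨hcm, hj.symm⟩
    · intro b hb hbc
      simp only [Finset.mem_filter, Finset.mem_univ, true_and] at hb
      by_contra hne
      exact hbc (huniq b hb.1 hne (by omega))
  · intro r v hv
    rw [← hAB, Matrix.mul_apply]
    refine Finset.sum_eq_zero fun s _ => ?_
    rw [hBz s v, mul_zero]
    have := colength_aux c hcm hj.symm s
    rw [Fin.lt_def]
    omega

theorem minor_mem {R : Type*} [CommRing R] {m n : ℕ} (X : Matrix (Fin m) (Fin n) R)
    (c : Fin m → Fin n) (hc : StrictMono c) : (X.submatrix id c).det ∈ minorsIdeal m X :=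
  Ideal.subset_span ⟨id, c, Function.injective_id, hc.injective, rfl⟩

theorem tauSum_mem {R : Type*} [CommRing R] {m n : ℕ} (X : Matrix (Fin m) (Fin n) R) (j : ℕ) :
    tauSum X j ∈ minorsIdeal m X := by
  unfold tauSum
  refine Ideal.sum_mem _ fun c hc => ?_
  simp only [Finset.mem_filter, Finset.mem_univ, true_and] at hc
  exact minor_mem X c hc.1

theorem tauSum_mem' {R : Type*} [CommRing R] {m n : ℕ} (X Y : Matrix (Fin m) (Fin n) R) (j : ℕ)
    (h : ∀ a b, Y a b - X a b ∈ minorsIdeal m X) :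
    tauSum Y j ∈ minorsIdeal m X := by
  rw [← Ideal.Quotient.eq_zero_iff_mem, map_tauSum]
  have : Y.map (Ideal.Quotient.mk (minorsIdeal m X)) = X.map (Ideal.Quotient.mk _) := by
    ext a b
    exact Ideal.Quotient.eq.mpr (h a b)
  rw [this, ← map_tauSum, Ideal.Quotient.eq_zero_iff_mem]
  exact tauSum_mem X j

theorem fill_aux {R : Type*} [CommRing R] {m n : ℕ} (X : Matrix (Fin m) (Fin n) R)
    (pos : ℕ → Fin m × Fin n) (k : ℕ)
    (hinj : ∀ a < k, ∀ b < k, pos a = pos b → a = b)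
    (hcol : ∀ l < k, ((pos l).2 : ℕ) + l < n - m)
    (hz : ∀ l < k, X (pos l).1 (pos l).2 = 0) :
    ∃ Y : Matrix (Fin m) (Fin n) R, (∀ a b, Y a b - X a b ∈ minorsIdeal m X) ∧
      (∀ a b, (∀ l < k, pos l ≠ (a, b)) → Y a b = X a b) ∧
      (∀ l < k, Y (pos l).1 (pos l).2 = tauSum Y l) := by
  classical
  induction k with
  | zero => exact ⟨X, by simp, by simp, by simp⟩
  | succ k ih =>
    obtain ⟨Y, h1, h2, h3⟩ := ih (fun a ha b hb => hinj a (by omega) b (by omega))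
      (fun l hl => hcol l (by omega)) (fun l hl => hz l (by omega))
    let Z : Matrix (Fin m) (Fin n) R := fun a b => if pos k = (a, b) then tauSum Y k else Y a b
    have hZ : ∀ a b, pos k ≠ (a, b) → Z a b = Y a b := fun a b h => if_neg h
    have hZk : Z (pos k).1 (pos k).2 = tauSum Y k := if_pos rfl
    have hloc : ∀ l ≤ k, tauSum Z l = tauSum Y l := by
      intro l hl
      refine tauSum_congr _ _ _ fun r v hv => hZ _ _ fun he => ?_
      have := hcol k (by omega)
      rw [he] at this
      simp only at this
      omega
    refine ⟨Z, ?_, ?_, ?_⟩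
    · intro a b
      by_cases h : pos k = (a, b)
      · have e1 : Z a b = tauSum Y k := if_pos h
        have e2 := hz k (by omega)
        rw [h] at e2
        simp only at e2
        rw [e1, e2, sub_zero]
        exact tauSum_mem' X Y k h1
      · rw [hZ a b h]; exact h1 a b
    · intro a b h
      rw [hZ a b (h k (by omega))]
      exact h2 a b fun l hl => h l (by omega)
    · intro l hl
      by_cases hlk : l = k
      · subst hlk; rw [hZk, hloc l le_rfl]
      · rw [hloc l (by omega), ← h3 l (by omega)]
        refine hZ _ _ fun he => hlk ?_
        exact (hinj k (by omega) l hl he).symm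

theorem core_aux {R : Type*} [CommRing R] {m n : ℕ} (hmn : m ≤ n)
    (X : Matrix (Fin m) (Fin n) R) (pos : ℕ → Fin m × Fin n) (k : ℕ)
    (hinj : ∀ a < k, ∀ b < k, pos a = pos b → a = b)
    (hcol : ∀ l < k, ((pos l).2 : ℕ) + l < n - m)
    (hz : ∀ l < k, X (pos l).1 (pos l).2 = 0) :
    ∃ f : Fin (m * (n - m) - k + 1) → R,
      (Ideal.span (Set.range f)).radical = (minorsIdeal m X).radical := by
  obtain ⟨Y, h1, h2, h3⟩ := fill_aux X pos k hinj hcol hz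
  refine ⟨fun i => tauSum Y (k + i), le_antisymm ?_ ?_⟩
  · refine Ideal.radical_mono (Ideal.span_le.mpr ?_)
    rintro _ ⟨i, rfl⟩
    exact tauSum_mem' X Y _ h1
  · rw [Ideal.radical_le_radical_iff]
    rw [Ideal.radical_eq_sInf]
    refine le_sInf ?_
    rintro P ⟨hJ, hP⟩
    let F := FractionRing (R ⧸ P)
    let φ : R →+* F := (algebraMap (R ⧸ P) F).comp (Ideal.Quotient.mk P)
    have hφ : ∀ x, φ x = 0 ↔ x ∈ P := by
      intro x
      simp only [φ, RingHom.comp_apply]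
      rw [FaithfulSMul.algebraMap_eq_zero_iff, Ideal.Quotient.eq_zero_iff_mem]
    have hM : ∀ c : Fin m → Fin n, Function.Injective c →
        ((Y.map φ).submatrix id c).det = 0 := by
      intro c hc
      by_contra hne
      obtain ⟨j, hj, hj1, hj2⟩ := gale_aux hmn (Y.map φ) c hc hne
      by_cases hjk : j < k
      · have e := hj2 (pos j).1 (pos j).2 (hcol j hjk)
        rw [Matrix.map_apply, h3 j hjk, map_tauSum] at e
        exact hj1 e
      · rw [← map_tauSum] at hj1
        apply hj1
        rw [hφ]
        refine hJ (Ideal.subset_span ⟨⟨j - k, by omega⟩, ?_⟩)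
        simp only
        congr 1
        omega
    have hτ : ∀ j, φ (tauSum Y j) = 0 := by
      intro j
      rw [map_tauSum]
      unfold tauSum
      refine Finset.sum_eq_zero fun c hc => ?_
      simp only [Finset.mem_filter, Finset.mem_univ, true_and] at hc
      exact hM c hc.1.injective
    have hXY : Y.map φ = X.map φ := by
      ext a b
      simp only [Matrix.map_apply]
      by_cases h : ∃ l < k, pos l = (a, b)
      · obtain ⟨l, hl, he⟩ := h
        have e1 := h3 l hl
        have e2 := hz l hl
        rw [he] at e1 e2
        simp only at e1 e2
        rw [e1, e2, hτ, map_zero]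
      · push Not at h
        rw [h2 a b h]
    rw [hXY] at hM
    refine Ideal.span_le.mpr ?_
    rintro d ⟨r, c, hr, hc, rfl⟩
    show _ ∈ P
    let e : Fin m ≃ Fin m := Equiv.ofBijective r (Finite.injective_iff_bijective.mp hr)
    have e1 : X.submatrix r c = (X.submatrix id (c ∘ e.symm)).submatrix e e := by
      ext a b
      simp [e]
    rw [e1, Matrix.det_submatrix_equiv_self, ← hφ, RingHom.map_det]
    exact hM _ (hc.comp e.symm.injective)

theorem minorsIdeal_perm {R : Type*} [CommRing R] {m n : ℕ} (X : Matrix (Fin m) (Fin n) R)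
    (e : Equiv.Perm (Fin n)) : minorsIdeal m (X.submatrix id e) = minorsIdeal m X := by
  unfold minorsIdeal
  congr 1
  ext d
  constructor
  · rintro ⟨r, c, hr, hc, rfl⟩
    exact ⟨r, e ∘ c, hr, e.injective.comp hc, rfl⟩
  · rintro ⟨r, c, hr, hc, rfl⟩
    refine ⟨r, e.symm ∘ c, hr, e.symm.injective.comp hc, ?_⟩
    congr 1
    ext a b
    simp

/-- The columns can be permuted so that the `l`-th prescribed column comes among the first
`l + 1` ones. -/
theorem perm_aux {n k : ℕ} (p : Fin k → Fin n) :
    ∃ e : Equiv.Perm (Fin n), ∀ l : Fin k, (e.symm (p l) : ℕ) ≤ l := by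
  classical
  let κ : Fin n → ℕ := fun c => if h : ∃ l : ℕ, ∃ hl : l < k, p ⟨l, hl⟩ = c then Nat.find h
    else k + c
  have hκ1 : ∀ c (h : ∃ l : ℕ, ∃ hl : l < k, p ⟨l, hl⟩ = c), κ c = Nat.find h :=
    fun c h => dif_pos h
  have hκ2 : ∀ c, ¬ (∃ l : ℕ, ∃ hl : l < k, p ⟨l, hl⟩ = c) → κ c = k + c :=
    fun c h => dif_neg h
  have hinj : Function.Injective κ := by
    intro a b hab
    by_cases ha : ∃ l : ℕ, ∃ hl : l < k, p ⟨l, hl⟩ = a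
    · obtain ⟨ha1, ha2⟩ := Nat.find_spec ha
      have ha3 := hκ1 a ha
      by_cases hb : ∃ l : ℕ, ∃ hl : l < k, p ⟨l, hl⟩ = b
      · obtain ⟨hb1, hb2⟩ := Nat.find_spec hb
        have hb3 := hκ1 b hb
        rw [← ha2, ← hb2]
        congr 2
        omega
      · have := hκ2 b hb
        omega
    · have ha3 := hκ2 a ha
      by_cases hb : ∃ l : ℕ, ∃ hl : l < k, p ⟨l, hl⟩ = b
      · obtain ⟨hb1, hb2⟩ := Nat.find_spec hb
        have hb3 := hκ1 b hb
        omega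
      · have := hκ2 b hb
        ext
        omega
  refine ⟨Tuple.sort κ, fun l => ?_⟩
  have hs : StrictMono (κ ∘ Tuple.sort κ) :=
    (Tuple.monotone_sort κ).strictMono_of_injective (hinj.comp (Equiv.injective _))
  have h := strictMono_le_aux _ hs ((Tuple.sort κ).symm (p l))
  simp only [Function.comp_apply, Equiv.apply_symm_apply] at h
  have hex : ∃ l' : ℕ, ∃ hl : l' < k, p ⟨l', hl⟩ = p l := ⟨l, l.2, rfl⟩
  rw [hκ1 _ hex] at h
  exact h.trans (Nat.find_min' hex ⟨l.2, rfl⟩)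

/-- If `k ≤ n - m` entries of the `(m × n)`-matrix `X` are zero, then the ideal of
maximal minors satisfies `ara I_m(X) ≤ mn - m² - k + 1`. -/
theorem stmt6 {K : Type*} [Field K] [IsAlgClosed K] (N m n k : ℕ)
    (X : Matrix (Fin m) (Fin n) (MvPolynomial (Fin N) K))
    (hmn : m ≤ n) (hk : k ≤ n - m)
    (hzeros : ∃ pos : Fin k → Fin m × Fin n, Function.Injective pos ∧
      ∀ h : Fin k, X (pos h).1 (pos h).2 = 0) :
    araRank (minorsIdeal m X) ≤ m * n - m ^ 2 - k + 1 := by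
  obtain ⟨pos, hinj, hz⟩ := hzeros
  have hD : m * n - m ^ 2 = m * (n - m) := by rw [Nat.mul_sub, sq]
  rw [hD]
  apply Nat.sInf_le
  obtain ⟨e, he⟩ := perm_aux (fun l => (pos l).2)
  rw [← minorsIdeal_perm X e]
  rcases Nat.eq_zero_or_pos k with h0 | h0
  · subst h0
    rcases Nat.eq_zero_or_pos m with hm | hm
    · subst hm
      refine ⟨fun _ => 1, ?_⟩
      congr 1
      have h1 : (1 : MvPolynomial (Fin N) K) ∈ minorsIdeal 0 (X.submatrix id e) :=
        Ideal.subset_span ⟨id, Fin.elim0, Function.injective_id,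
          fun a => a.elim0, by simp⟩
      rw [(Ideal.eq_top_iff_one _).mpr h1, Ideal.eq_top_iff_one]
      exact Ideal.subset_span ⟨0, rfl⟩
    · exact core_aux hmn _ (fun _ => (⟨0, hm⟩, ⟨0, by omega⟩)) 0 (by simp) (by simp) (by simp)
  · have hlt : ∀ l, k - 1 - l < k := fun l => by omega
    refine core_aux hmn _
      (fun l => ((pos ⟨k - 1 - l, hlt l⟩).1, e.symm (pos ⟨k - 1 - l, hlt l⟩).2)) k ?_ ?_ ?_
    · intro a ha b hb hab
      simp only [Prod.mk.injEq, EmbeddingLike.apply_eq_iff_eq] at hab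
      have := hinj (Prod.ext hab.1 hab.2)
      simp only [Fin.mk.injEq] at this
      omega
    · intro l hl
      have := he ⟨k - 1 - l, hlt l⟩
      simp only at this ⊢
      omega
    · intro l hl
      simpa using hz ⟨k - 1 - l, hlt l⟩
end

section
/- Let K be an algebraically closed field, R = K[x_1,…,x_N] a polynomial ring over K, n ≥ 3 and k ≥ 0 integers, and X a (2×n)-matrix with entries in R. Suppose that k entries of X lying outside the (2×2)-submatrix formed by columns n−1 and n are zero. Then ara I_2(X) ≤ 2n − 3 − k. -/
namespace Stmt9Aux

/-- The minor on columns `i`, `j`. -/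
def br {R : Type*} [CommRing R] (x y : ℕ → R) (i j : ℕ) : R := x i * y j - x j * y i

/-- The sum of the minors on columns `i < j` with `i + j = s`. -/
def F {R : Type*} [CommRing R] (x y : ℕ → R) (s : ℕ) : R :=
  ∑ i ∈ Finset.range ((s + 1) / 2), br x y i (s - i)

lemma br_swap {R : Type*} [CommRing R] (x y : ℕ → R) (i j : ℕ) :
    br x y i j = - br x y j i := by
  unfold br; ring

lemma br_self {R : Type*} [CommRing R] (x y : ℕ → R) (i : ℕ) : br x y i i = 0 := by
  unfold br; ring

lemma br_mul {R : Type*} [CommRing R] (x y : ℕ → R) (i j k l : ℕ) :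
    br x y i j * br x y k l = br x y i k * br x y j l - br x y i l * br x y j k := by
  unfold br; ring

lemma F_congr {R : Type*} [CommRing R] (x y x' y' : ℕ → R) (s : ℕ)
    (hx : ∀ j ≤ s, x j = x' j) (hy : ∀ j ≤ s, y j = y' j) : F x y s = F x' y' s := by
  unfold F br
  refine Finset.sum_congr rfl fun i hi => ?_
  rw [Finset.mem_range] at hi
  rw [hx i (by omega), hx (s - i) (by omega), hy i (by omega), hy (s - i) (by omega)]

lemma F_zero {R : Type*} [CommRing R] (x y : ℕ → R) (s : ℕ)
    (h : ∀ i j, br x y i j = 0) : F x y s = 0 := by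
  unfold F
  exact Finset.sum_eq_zero fun i _ => h _ _

lemma F_map {R D : Type*} [CommRing R] [CommRing D] (φ : R →+* D) (x y : ℕ → R) (s : ℕ) :
    φ (F x y s) = F (fun i => φ (x i)) (fun i => φ (y i)) s := by
  simp [F, br]

lemma prod_zero {D : Type*} [CommRing D] (x y : ℕ → D) (s i j k l : ℕ)
    (hs : ∀ a b, s < a + b → br x y a b = 0)
    (hij : i + j = s) (hkl : k + l = s) (hik : i < k) (h2 : k < l) :
    br x y i j * br x y k l = 0 := by
  rw [br_mul, hs j l (by omega), hs j k (by omega)]; ring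

lemma step {D : Type*} [CommRing D] [IsDomain D] (x y : ℕ → D) (s : ℕ)
    (hs : ∀ a b, s < a + b → br x y a b = 0) (hF : F x y s = 0) (i j : ℕ) (hij : i + j = s) :
    br x y i j = 0 := by
  have key : ∀ i j, i + j = s → i < j → br x y i j = 0 := by
    intro i j hij hlt
    have h1 : F x y s * br x y i j = br x y i j * br x y i j := by
      unfold F
      rw [Finset.sum_mul, Finset.sum_eq_single i]
      · rw [show s - i = j by omega]
      · intro k hk hne
        rw [Finset.mem_range] at hk
        rcases lt_or_gt_of_ne hne with h | h
        · exact prod_zero x y s k (s - k) i j hs (by omega) hij h hlt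
        · rw [mul_comm]
          exact prod_zero x y s i j k (s - k) hs hij (by omega) h (by omega)
      · intro h
        exact absurd (Finset.mem_range.2 (by omega)) h
    rw [hF, zero_mul] at h1
    exact mul_self_eq_zero.1 h1.symm
  rcases lt_trichotomy i j with h | h | h
  · exact key i j hij h
  · subst h; exact br_self x y i
  · rw [br_swap, key j i (by omega) h, neg_zero]

lemma lemA {D : Type*} [CommRing D] [IsDomain D] (x y : ℕ → D) (m t : ℕ)
    (hx : ∀ j, m ≤ j → x j = 0) (hy : ∀ j, m ≤ j → y j = 0)
    (hF : ∀ s, t ≤ s → F x y s = 0) : ∀ i j, t ≤ i + j → br x y i j = 0 := by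
  have : ∀ d i j, t ≤ i + j → 2 * m ≤ i + j + d → br x y i j = 0 := by
    intro d
    induction d with
    | zero =>
      intro i j _ h
      rcases le_or_gt m i with h' | h'
      · simp [br, hx i h', hy i h']
      · simp [br, hx j (by omega), hy j (by omega)]
    | succ d ih =>
      intro i j ht h
      exact step x y (i + j) (fun a b hab => ih a b (by omega) (by omega)) (hF _ ht) i j rfl
  intro i j h
  exact this (2 * m) i j h (by omega)

lemma lemB {D : Type*} [CommRing D] [IsDomain D] (x y : ℕ → D) (t : ℕ)
    (h : ∀ i j, t ≤ i + j → br x y i j = 0) (hne : ¬ (x t = 0 ∧ y t = 0)) :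
    ∀ i j, br x y i j = 0 := by
  intro i j
  have h1 := h t i (by omega)
  have h2 := h t j (by omega)
  have e1 : x t * br x y i j = 0 := by
    have : x t * br x y i j = x i * br x y t j - x j * br x y t i := by unfold br; ring
    rw [this, h1, h2]; ring
  have e2 : y t * br x y i j = 0 := by
    have : y t * br x y i j = y i * br x y t j - y j * br x y t i := by unfold br; ring
    rw [this, h1, h2]; ring
  by_contra hb
  exact hne ⟨(mul_eq_zero.1 e1).resolve_right hb, (mul_eq_zero.1 e2).resolve_right hb⟩

lemma lemC {D : Type*} [CommRing D] [IsDomain D] (x y : ℕ → D) (m k : ℕ)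
    (hx : ∀ j, m ≤ j → x j = 0) (hy : ∀ j, m ≤ j → y j = 0)
    (hF : ∀ s, k + 1 ≤ s → F x y s = 0)
    (hc : ∀ j, 2 ≤ j → j < k + 2 → x j = 0 → y j = 0 → F x y (j - 1) = 0) :
    ∀ i j, br x y i j = 0 := by
  induction k with
  | zero =>
    intro i j
    rcases Nat.eq_zero_or_pos (i + j) with h | h
    · obtain ⟨rfl, rfl⟩ : i = 0 ∧ j = 0 := by omega
      exact br_self x y 0
    · exact lemA x y m 1 hx hy hF i j h
  | succ k ih =>
    by_cases hz : x (k + 2) = 0 ∧ y (k + 2) = 0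
    · refine ih (fun s hs => ?_) (fun j h1 h2 => hc j h1 (by omega))
      rcases Nat.eq_or_lt_of_le hs with h | h
      · subst h
        exact hc (k + 2) (by omega) (by omega) hz.1 hz.2
      · exact hF s h
    · exact lemB x y (k + 2) (lemA x y m (k + 2) hx hy hF) hz

lemma exists_mod {R : Type*} [CommRing R] (x y : ℕ → R) (k : ℕ)
    (h0 : ∀ j, 2 ≤ j → j < k + 2 → x j = 0 ∨ y j = 0) :
    ∃ x' y' : ℕ → R, (∀ j, j < 2 ∨ k + 2 ≤ j → x' j = x j ∧ y' j = y j) ∧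
      ∀ j, 2 ≤ j → j < k + 2 →
        (x j = 0 ∧ x' j = F x' y' (j - 1) ∧ y' j = y j) ∨
        (y j = 0 ∧ y' j = F x' y' (j - 1) ∧ x' j = x j) := by
  induction k with
  | zero => exact ⟨x, y, fun j _ => ⟨rfl, rfl⟩, fun j h1 h2 => by omega⟩
  | succ k ih =>
    obtain ⟨x', y', h1, h2⟩ := ih (fun j a b => h0 j a (by omega))
    have hk := h1 (k + 2) (by omega)
    rcases h0 (k + 2) (by omega) (by omega) with hz | hz
    · have hF : ∀ s, s < k + 2 →
          F (Function.update x' (k + 2) (F x' y' (k + 1))) y' s = F x' y' s := fun s hs =>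
        F_congr _ _ _ _ s (fun j hj => Function.update_of_ne (by omega) _ _) (fun _ _ => rfl)
      refine ⟨Function.update x' (k + 2) (F x' y' (k + 1)), y', fun j hj => ?_, fun j a b => ?_⟩
      · rw [Function.update_of_ne (by omega)]
        exact h1 j (by omega)
      · rw [hF (j - 1) (by omega)]
        rcases Nat.eq_or_lt_of_le (Nat.le_of_lt_succ b) with h | h
        · subst h
          left
          exact ⟨hz, by simp, hk.2⟩
        · rw [Function.update_of_ne (by omega)]
          exact h2 j a (by omega)
    · have hF : ∀ s, s < k + 2 →
          F x' (Function.update y' (k + 2) (F x' y' (k + 1))) s = F x' y' s := fun s hs =>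
        F_congr _ _ _ _ s (fun _ _ => rfl) (fun j hj => Function.update_of_ne (by omega) _ _)
      refine ⟨x', Function.update y' (k + 2) (F x' y' (k + 1)), fun j hj => ?_, fun j a b => ?_⟩
      · rw [Function.update_of_ne (by omega)]
        exact h1 j (by omega)
      · rw [hF (j - 1) (by omega)]
        rcases Nat.eq_or_lt_of_le (Nat.le_of_lt_succ b) with h | h
        · subst h
          right
          exact ⟨hz, by simp, hk.1⟩
        · rw [Function.update_of_ne (by omega)]
          exact h2 j a (by omega)

/-- The statement over a domain. -/
lemma domain_iff {D : Type*} [CommRing D] [IsDomain D] (x y x' y' : ℕ → D) (m k : ℕ)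
    (hkm : k + 2 ≤ m) (hx : ∀ j, m ≤ j → x j = 0) (hy : ∀ j, m ≤ j → y j = 0)
    (h1 : ∀ j, j < 2 ∨ k + 2 ≤ j → x' j = x j ∧ y' j = y j)
    (h2 : ∀ j, 2 ≤ j → j < k + 2 →
        (x j = 0 ∧ x' j = F x' y' (j - 1) ∧ y' j = y j) ∨
        (y j = 0 ∧ y' j = F x' y' (j - 1) ∧ x' j = x j)) :
    (∀ s, k + 1 ≤ s → s ≤ 2 * m - 3 → F x' y' s = 0) ↔ ∀ i j, br x y i j = 0 := by
  have hx' : ∀ j, m ≤ j → x' j = 0 := fun j hj => by rw [(h1 j (by omega)).1, hx j hj]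
  have hy' : ∀ j, m ≤ j → y' j = 0 := fun j hj => by rw [(h1 j (by omega)).2, hy j hj]
  constructor
  · intro hF
    have hF' : ∀ s, k + 1 ≤ s → F x' y' s = 0 := by
      intro s hs
      rcases le_or_gt s (2 * m - 3) with h | h
      · exact hF s hs h
      · unfold F
        refine Finset.sum_eq_zero fun i hi => ?_
        rw [Finset.mem_range] at hi
        simp [br, hx' (s - i) (by omega), hy' (s - i) (by omega)]
    have hb : ∀ i j, br x' y' i j = 0 := by
      refine lemC x' y' m k hx' hy' hF' fun j a b ha hb => ?_
      rcases h2 j a b with h | h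
      · rw [← h.2.1, ha]
      · rw [← h.2.1, hb]
    have heq : ∀ j, x' j = x j ∧ y' j = y j := by
      intro j
      by_cases hj : j < 2 ∨ k + 2 ≤ j
      · exact h1 j hj
      · rcases h2 j (by omega) (by omega) with h | h
        · exact ⟨by rw [h.2.1, h.1, F_zero _ _ _ hb], h.2.2⟩
        · exact ⟨h.2.2, by rw [h.2.1, h.1, F_zero _ _ _ hb]⟩
    intro i j
    have := hb i j
    unfold br at this ⊢
    rwa [(heq i).1, (heq i).2, (heq j).1, (heq j).2] at this
  · intro hb
    have heq : ∀ j, x' j = x j ∧ y' j = y j := by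
      intro j
      induction j using Nat.strong_induction_on with
      | _ j ih =>
        by_cases hj : j < 2 ∨ k + 2 ≤ j
        · exact h1 j hj
        · have hz : F x' y' (j - 1) = 0 := by
            rw [F_congr x' y' x y (j - 1) (fun i hi => (ih i (by omega)).1)
              (fun i hi => (ih i (by omega)).2)]
            exact F_zero _ _ _ hb
          rcases h2 j (by omega) (by omega) with h | h
          · exact ⟨by rw [h.2.1, h.1, hz], h.2.2⟩
          · exact ⟨h.2.2, by rw [h.2.1, h.1, hz]⟩
    intro s _ _
    rw [F_congr x' y' x y s (fun i _ => (heq i).1) (fun i _ => (heq i).2)]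
    exact F_zero _ _ _ hb

lemma radical_eq_of_primes {R : Type*} [CommRing R] (A B : Ideal R)
    (h : ∀ P : Ideal R, P.IsPrime → (A ≤ P ↔ B ≤ P)) : A.radical = B.radical := by
  rw [Ideal.radical_eq_sInf, Ideal.radical_eq_sInf]
  congr 1
  ext P
  exact ⟨fun hP => ⟨(h P hP.2).1 hP.1, hP.2⟩, fun hP => ⟨(h P hP.2).2 hP.1, hP.2⟩⟩

lemma core {R : Type*} [CommRing R] (x y : ℕ → R) (m k : ℕ)
    (hkm : k + 2 ≤ m) (hx : ∀ j, m ≤ j → x j = 0) (hy : ∀ j, m ≤ j → y j = 0)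
    (h0 : ∀ j, 2 ≤ j → j < k + 2 → x j = 0 ∨ y j = 0) :
    ∃ f : Fin (2 * m - 3 - k) → R, ∀ P : Ideal R, P.IsPrime →
      (Ideal.span (Set.range f) ≤ P ↔ ∀ i j, br x y i j ∈ P) := by
  obtain ⟨x', y', h1, h2⟩ := exists_mod x y k h0
  refine ⟨fun i => F x' y' (k + 1 + i), fun P hP => ?_⟩
  let φ := Ideal.Quotient.mk P
  have key := domain_iff (fun i => φ (x i)) (fun i => φ (y i)) (fun i => φ (x' i))
    (fun i => φ (y' i)) m k hkm (fun j hj => by simp [hx j hj]) (fun j hj => by simp [hy j hj])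
    (fun j hj => by simp [h1 j hj])
    (fun j a b => by
      rw [← F_map]
      rcases h2 j a b with h | h
      · left
        exact ⟨by simp [h.1], by simp only [← h.2.1], by simp only [h.2.2]⟩
      · right
        exact ⟨by simp [h.1], by simp only [← h.2.1], by simp only [h.2.2]⟩)
  have e1 : (Ideal.span (Set.range fun i : Fin (2 * m - 3 - k) => F x' y' (k + 1 + i)) ≤ P) ↔
      ∀ s, k + 1 ≤ s → s ≤ 2 * m - 3 →
        F (fun i => φ (x' i)) (fun i => φ (y' i)) s = 0 := by
    rw [Ideal.span_le]
    constructor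
    · intro h s a b
      rw [← F_map]
      refine Ideal.Quotient.eq_zero_iff_mem.2 (h ⟨⟨s - (k + 1), by omega⟩, ?_⟩)
      change F x' y' (k + 1 + (s - (k + 1))) = _
      rw [show k + 1 + (s - (k + 1)) = s by omega]
    · rintro h _ ⟨i, rfl⟩
      have := h (k + 1 + i) (by omega) (by omega)
      rw [← F_map] at this
      exact Ideal.Quotient.eq_zero_iff_mem.1 this
  rw [e1, key]
  refine forall_congr' fun i => forall_congr' fun j => ?_
  rw [← Ideal.Quotient.eq_zero_iff_mem]
  simp [br, φ]

/-- The core lemma for a list enumerating the nonzero columns. -/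
lemma core_list {R : Type*} [CommRing R] {n : ℕ} (X : Matrix (Fin 2) (Fin n) R)
    (l : List (Fin n)) (k : ℕ) (hk : k + 2 ≤ l.length)
    (hl : ∀ c, c ∈ l ∨ (X 0 c = 0 ∧ X 1 c = 0))
    (h0 : ∀ j (hj : j < l.length), 2 ≤ j → j < k + 2 → X 0 l[j] = 0 ∨ X 1 l[j] = 0) :
    araRank (minorsIdeal 2 X) ≤ 2 * l.length - 3 - k := by
  let z : Fin 2 → ℕ → R := fun r j => if h : j < l.length then X r l[j] else 0
  have hz : ∀ r j, (h : j < l.length) → z r j = X r l[j] := fun r j h => dif_pos h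
  have hz' : ∀ r j, l.length ≤ j → z r j = 0 := fun r j h => dif_neg (by omega)
  obtain ⟨f, hf⟩ := core (z 0) (z 1) l.length k hk (hz' 0) (hz' 1) (fun j a b => by
    rw [hz 0 j (by omega), hz 1 j (by omega)]
    exact h0 j (by omega) a b)
  refine Nat.sInf_le ⟨f, radical_eq_of_primes _ _ fun P hP => ?_⟩
  rw [hf P hP]
  unfold minorsIdeal
  rw [Ideal.span_le]
  constructor
  · rintro h _ ⟨r, c, hr, hc, rfl⟩
    have hm : ∀ a b, X 0 a * X 1 b - X 0 b * X 1 a ∈ P := by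
      intro a b
      rcases hl a with ha | ha
      · rcases hl b with hb | hb
        · obtain ⟨i, hi, rfl⟩ := List.getElem_of_mem ha
          obtain ⟨j, hj, rfl⟩ := List.getElem_of_mem hb
          have := h i j
          unfold br at this
          rwa [hz 0 i hi, hz 1 i hi, hz 0 j hj, hz 1 j hj] at this
        · simp [hb.1, hb.2]
      · simp [ha.1, ha.2]
    rw [Matrix.det_fin_two]
    simp only [Matrix.submatrix_apply]
    have hne : r 0 ≠ r 1 := fun h => by simpa using hr h
    have : (r 0 = 0 ∧ r 1 = 1) ∨ (r 0 = 1 ∧ r 1 = 0) := by omega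
    rcases this with ⟨e0, e1⟩ | ⟨e0, e1⟩
    · rw [e0, e1]; exact hm _ _
    · rw [e0, e1]
      have := hm (c 1) (c 0)
      rw [SetLike.mem_coe]
      rwa [mul_comm (X 1 (c 0)), mul_comm (X 1 (c 1))]
  · intro h i j
    unfold br
    rcases lt_or_ge i l.length with hi | hi
    · rcases lt_or_ge j l.length with hj | hj
      · rw [hz 0 i hi, hz 1 i hi, hz 0 j hj, hz 1 j hj]
        by_cases hc : l[i] = l[j]
        · rw [hc, sub_self]; exact P.zero_mem
        · refine h ⟨id, ![l[i], l[j]], Function.injective_id, ?_, ?_⟩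
          · intro a b hab
            fin_cases a <;> fin_cases b <;> simp_all
          · rw [Matrix.det_fin_two]; simp
      · simp [hz' 0 j hj, hz' 1 j hj]
    · simp [hz' 0 i hi, hz' 1 i hi]

end Stmt9Aux

/-- If `k` entries of a `(2 × n)`-matrix `X` (`n ≥ 3`) lying outside the last two
columns are zero, then `ara I_2(X) ≤ 2n - 3 - k`. -/
theorem stmt9 {K : Type*} [Field K] [IsAlgClosed K] (N n k : ℕ) (hn : 3 ≤ n)
    (X : Matrix (Fin 2) (Fin n) (MvPolynomial (Fin N) K))
    (hzeros : ∃ pos : Fin k → Fin 2 × Fin n, Function.Injective pos ∧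
      ∀ h : Fin k, ((pos h).2 : ℕ) < n - 2 ∧ X (pos h).1 (pos h).2 = 0) :
    araRank (minorsIdeal 2 X) ≤ 2 * n - 3 - k := by
  classical
  obtain ⟨pos, hinj, hpos⟩ := hzeros
  let B : Finset (Fin n) := Finset.univ.filter fun c => (c : ℕ) < n - 2
  let A : Fin 2 → Finset (Fin n) := fun r => B.filter fun c => X r c = 0
  let S := (A 0 ∪ A 1) \ (A 0 ∩ A 1)
  let T := B \ (A 0 ∪ A 1)
  have hB : B.card = n - 2 := by
    have : B = Finset.univ.map (Fin.castLEEmb (show n - 2 ≤ n by omega)) := by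
      ext c
      simp only [B, Finset.mem_filter, Finset.mem_univ, true_and, Finset.mem_map]
      exact ⟨fun h => ⟨⟨c, h⟩, rfl⟩, by rintro ⟨a, rfl⟩; exact a.2⟩
    rw [this]; simp
  have hAB : A 0 ∪ A 1 ⊆ B :=
    Finset.union_subset (Finset.filter_subset _ _) (Finset.filter_subset _ _)
  have hS : S.card + (A 0 ∩ A 1).card = (A 0 ∪ A 1).card :=
    Finset.card_sdiff_add_card_eq_card
      (Finset.inter_subset_left.trans Finset.subset_union_left)
  have hT : T.card + (A 0 ∪ A 1).card = B.card := Finset.card_sdiff_add_card_eq_card hAB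
  have hU : (A 0 ∪ A 1).card + (A 0 ∩ A 1).card = (A 0).card + (A 1).card :=
    Finset.card_union_add_card_inter _ _
  have hk : k ≤ (A 0).card + (A 1).card := by
    have h1 : Finset.univ.image pos ⊆ (A 0).image (fun c => ((0 : Fin 2), c)) ∪
        (A 1).image (fun c => ((1 : Fin 2), c)) := by
      intro p hp
      obtain ⟨h, -, rfl⟩ := Finset.mem_image.1 hp
      obtain ⟨a, b⟩ := hpos h
      generalize pos h = q at a b
      obtain ⟨r, c⟩ := q
      fin_cases r
      · refine Finset.mem_union_left _ (Finset.mem_image.2 ⟨c, ?_, rfl⟩)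
        simpa [A, B] using ⟨a, b⟩
      · refine Finset.mem_union_right _ (Finset.mem_image.2 ⟨c, ?_, rfl⟩)
        simpa [A, B] using ⟨a, b⟩
    have h2 := Finset.card_le_card h1
    rw [Finset.card_image_of_injective _ hinj, Finset.card_univ, Fintype.card_fin] at h2
    exact h2.trans ((Finset.card_union_le _ _).trans
      (add_le_add Finset.card_image_le Finset.card_image_le))
  let l : List (Fin n) :=
    [⟨n - 2, by omega⟩, ⟨n - 1, by omega⟩] ++ (S.toList ++ T.toList)
  have hlen : l.length = 2 + (S.card + T.card) := by
    simp [l]; omega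
  have := Stmt9Aux.core_list X l S.card (by omega) ?_ ?_
  · omega
  · intro c
    by_cases hc : (c : ℕ) < n - 2
    · have hcB : c ∈ B := by simpa [B] using hc
      by_cases hz : c ∈ A 0 ∩ A 1
      · right
        have := Finset.mem_inter.1 hz
        exact ⟨(Finset.mem_filter.1 this.1).2, (Finset.mem_filter.1 this.2).2⟩
      · left
        refine List.mem_append_right _ (List.mem_append.2 ?_)
        rw [Finset.mem_toList, Finset.mem_toList]
        by_cases hu : c ∈ A 0 ∪ A 1
        · exact Or.inl (Finset.mem_sdiff.2 ⟨hu, hz⟩)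
        · exact Or.inr (Finset.mem_sdiff.2 ⟨hcB, hu⟩)
    · left
      refine List.mem_append_left _ ?_
      simp only [List.mem_cons, List.not_mem_nil, or_false, Fin.ext_iff]
      omega
  · intro j hj h2 h3
    have hmem : l[j] ∈ S := by
      have : l[j] = S.toList[j - 2]'(by simp; omega) := by
        simp only [l]
        rw [List.getElem_append_right (by simpa using h2), List.getElem_append_left]
        rfl
      rw [this, ← Finset.mem_toList]
      exact List.getElem_mem _
    have := (Finset.mem_sdiff.1 hmem).1
    rcases Finset.mem_union.1 this with h | h
    · exact Or.inl (Finset.mem_filter.1 h).2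
    · exact Or.inr (Finset.mem_filter.1 h).2
end
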